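/- arXiv:2206.08054 — 11 statements merged into one kernel-verified Lean document; each statement's English description precedes it below -/
import Mathlib

section
/- Let A ∈ ℝ^{m×n} have singular value decomposition A = UΣVᵀ, let k be a positive integer not exceeding the rank of A, let S ∈ ℝ^{n×r} be a column sampling matrix, and set C = AS. Then ‖CC⁺U_k‖_F² ≥ ‖V_kᵀS‖_F². -/
open Matrix BigOperators Finset

/-- The four Penrose conditions: `P` is the Moore–Penrose pseudoinverse of `M`. -/
def IsMoorePenrose {a b : Type*} [Fintype a] [Fintype b]
    (M : Matrix a b ℝ) (P : Matrix b a ℝ) : Prop :=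
  M * P * M = M ∧ P * M * P = P ∧ (M * P)ᵀ = M * P ∧ (P * M)ᵀ = P * M

section WeightedGram

variable {ι ρ : Type*} [Fintype ι] [Fintype ρ] [DecidableEq ι]

lemma dotProduct_weightedGram_mulVec (W : Matrix ι ρ ℝ) (c : ι → ℝ) (x : ρ → ℝ) :
    x ⬝ᵥ ((Wᵀ * diagonal c * W) *ᵥ x) = ∑ j, c j * (W *ᵥ x) j ^ 2 := by
  rw [← mulVec_mulVec, ← mulVec_mulVec, dotProduct_mulVec, vecMul_transpose, dotProduct]
  refine Finset.sum_congr rfl fun j _ => ?_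
  rw [mulVec_diagonal]
  ring

variable [DecidableEq ρ]

lemma le_dotProduct_weightedGram_mulVec {W : Matrix ι ρ ℝ} (hW : Wᵀ * W = 1) {c : ι → ℝ} {t : ℝ}
    (hc : ∀ j, t ≤ c j) (x : ρ → ℝ) :
    t * (x ⬝ᵥ x) ≤ x ⬝ᵥ ((Wᵀ * diagonal c * W) *ᵥ x) := by
  have h : x ⬝ᵥ x = ∑ j, (W *ᵥ x) j ^ 2 := by
    have := dotProduct_weightedGram_mulVec W (fun _ => 1) x
    simpa [hW] using this
  rw [dotProduct_weightedGram_mulVec, h, Finset.mul_sum]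
  gcongr with j
  exact hc j

lemma isUnit_weightedGram {W : Matrix ι ρ ℝ} (hW : Wᵀ * W = 1) {c : ι → ℝ} {t : ℝ}
    (ht : 0 < t) (hc : ∀ j, t ≤ c j) : IsUnit (Wᵀ * diagonal c * W) := by
  rw [← mulVec_injective_iff_isUnit, ← coe_mulVecLin, injective_iff_map_eq_zero]
  intro x hx
  have h := le_dotProduct_weightedGram_mulVec hW hc x
  rw [mulVecLin_apply] at hx
  rw [hx, dotProduct_zero] at h
  have h0 : 0 ≤ x ⬝ᵥ x := Finset.sum_nonneg fun i _ => mul_self_nonneg _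
  exact dotProduct_self_eq_zero.mp (le_antisymm (by nlinarith) h0)

lemma weightedGram_inv_dotProduct_le {W : Matrix ι ρ ℝ} (hW : Wᵀ * W = 1) {c : ι → ℝ} {t : ℝ}
    (ht : 0 < t) (hc : ∀ j, t ≤ c j) (w : ρ → ℝ) :
    t * (w ⬝ᵥ ((Wᵀ * diagonal c * W)⁻¹ *ᵥ w)) ≤ w ⬝ᵥ w := by
  have hdet := (isUnit_iff_isUnit_det _).mp (isUnit_weightedGram hW ht hc)
  set Y := Wᵀ * diagonal c * W with hY
  set z := Y⁻¹ *ᵥ w with hz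
  have hYz : Y *ᵥ z = w := by rw [hz, mulVec_mulVec, mul_nonsing_inv _ hdet, one_mulVec]
  have h := le_dotProduct_weightedGram_mulVec hW hc z
  rw [← hY, hYz, dotProduct_comm z w] at h
  have h0 : 0 ≤ (w - t • z) ⬝ᵥ (w - t • z) := Finset.sum_nonneg fun i _ => mul_self_nonneg _
  simp only [sub_dotProduct, dotProduct_sub, smul_dotProduct, dotProduct_smul, smul_eq_mul,
    dotProduct_comm z w] at h0
  nlinarith

lemma sum_mul_weightedGram_inv_dotProduct {W : Matrix ι ρ ℝ} (hW : Wᵀ * W = 1) {c : ι → ℝ}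
    {t : ℝ} (ht : 0 < t) (hc : ∀ j, t ≤ c j) :
    ∑ j, c j * (W j ⬝ᵥ ((Wᵀ * diagonal c * W)⁻¹ *ᵥ W j)) = ∑ j, W j ⬝ᵥ W j := by
  have hdet := (isUnit_iff_isUnit_det _).mp (isUnit_weightedGram hW ht hc)
  have hrow (M : Matrix ρ ρ ℝ) (j : ι) : W j ⬝ᵥ (M *ᵥ W j) = (W * M * Wᵀ) j j := by
    rw [dotProduct_mulVec]
    rfl
  have h1 : ∑ j, W j ⬝ᵥ W j = trace (1 : Matrix ρ ρ ℝ) := by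
    rw [← hW, trace_mul_comm]
    rfl
  rw [h1, ← mul_nonsing_inv _ hdet]
  generalize (Wᵀ * diagonal c * W)⁻¹ = Z
  rw [Matrix.mul_assoc, Matrix.mul_assoc, trace_mul_comm, Matrix.mul_assoc, trace]
  refine Finset.sum_congr rfl fun j _ => ?_
  rw [hrow, diag_apply, diagonal_mul]

end WeightedGram

lemma two_mul_dotProduct_sub_le_of_projection {a b : Type*} [Fintype a] [Fintype b]
    {P : Matrix a a ℝ} {C : Matrix a b ℝ} (hP : Pᵀ = P) (hPC : P * C = C)
    (u : a → ℝ) (g : b → ℝ) :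
    2 * (u ⬝ᵥ (C *ᵥ g)) - (C *ᵥ g) ⬝ᵥ (C *ᵥ g) ≤ ∑ l, (P *ᵥ u) l ^ 2 := by
  have h1 : (P *ᵥ u) ⬝ᵥ (C *ᵥ g) = u ⬝ᵥ (C *ᵥ g) := by
    rw [← hP, mulVec_transpose, ← dotProduct_mulVec, mulVec_mulVec, hPC]
  have h2 : ∑ l, (P *ᵥ u) l ^ 2 = (P *ᵥ u) ⬝ᵥ (P *ᵥ u) := by simp [dotProduct, sq]
  have h0 : 0 ≤ (P *ᵥ u - C *ᵥ g) ⬝ᵥ (P *ᵥ u - C *ᵥ g) :=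
    Finset.sum_nonneg fun i _ => mul_self_nonneg _
  rw [h2]
  simp only [sub_dotProduct, dotProduct_sub, dotProduct_comm (C *ᵥ g) (P *ᵥ u), h1] at h0
  linarith

lemma sum_filter_val_lt_eq_sum_castLE {n k : ℕ} (h : k ≤ n) (F : Fin n → ℝ) :
    ∑ i ∈ Finset.univ.filter (fun i : Fin n => (i : ℕ) < k), F i
      = ∑ i : Fin k, F (Fin.castLE h i) := by
  symm
  refine Finset.sum_bij (fun i _ => Fin.castLE h i) (by simp) (by simp) ?_ (by simp)
  intro i hi
  exact ⟨⟨i, by simpa using hi⟩, by simp, rfl⟩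

/-- The `m × n` rectangular diagonal matrix with diagonal entries `σ`. -/
def rectDiagonal (m n : ℕ) (σ : ℕ → ℝ) : Matrix (Fin m) (Fin n) ℝ :=
  Matrix.of fun (i : Fin m) (j : Fin n) => if (i : ℕ) = (j : ℕ) then σ i else 0

lemma rectDiagonal_mulVec_of_lt {m n : ℕ} (σ : ℕ → ℝ) (v : Fin n → ℝ) (i : Fin m)
    (hi : (i : ℕ) < n) : (rectDiagonal m n σ *ᵥ v) i = σ i * v ⟨i, hi⟩ := by
  rw [mulVec, dotProduct, Finset.sum_eq_single ⟨i, hi⟩]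
  · simp [rectDiagonal]
  · intro j _ hj
    have : (i : ℕ) ≠ j := fun h => hj (Fin.ext h.symm)
    simp [rectDiagonal, this]
  · simp

lemma rectDiagonal_mulVec_of_le {m n : ℕ} (σ : ℕ → ℝ) (v : Fin n → ℝ) (i : Fin m)
    (hi : n ≤ (i : ℕ)) : (rectDiagonal m n σ *ᵥ v) i = 0 := by
  rw [mulVec, dotProduct]
  refine Finset.sum_eq_zero fun j _ => ?_
  have : (i : ℕ) ≠ j := by lia
  simp [rectDiagonal, this]

lemma rectDiagonal_mulVec_dotProduct_self_le {m n : ℕ} (σ : ℕ → ℝ) (v : Fin n → ℝ) :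
    (rectDiagonal m n σ *ᵥ v) ⬝ᵥ (rectDiagonal m n σ *ᵥ v) ≤ ∑ j : Fin n, σ j ^ 2 * v j ^ 2 := by
  let F : ℕ → ℝ := fun l => if h : l < n then σ l ^ 2 * v ⟨l, h⟩ ^ 2 else 0
  have hF (l : ℕ) : 0 ≤ F l := by
    simp only [F]
    split_ifs <;> positivity
  have hl : (rectDiagonal m n σ *ᵥ v) ⬝ᵥ (rectDiagonal m n σ *ᵥ v) = ∑ l ∈ range m, F l := by
    rw [dotProduct, ← Fin.sum_univ_eq_sum_range]
    refine Finset.sum_congr rfl fun i _ => ?_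
    rcases lt_or_ge (i : ℕ) n with hi | hi
    · rw [rectDiagonal_mulVec_of_lt σ v i hi]
      simp only [F, hi, dite_true]
      ring
    · simp [F, rectDiagonal_mulVec_of_le σ v i hi, hi.not_gt]
  have hr : ∑ j : Fin n, σ j ^ 2 * v j ^ 2 = ∑ l ∈ range n, F l := by
    rw [← Fin.sum_univ_eq_sum_range]
    simp [F]
  rw [hl, hr]
  rcases le_total m n with h | h
  · exact Finset.sum_le_sum_of_subset_of_nonneg (Finset.range_mono h) fun l _ _ => hF l
  · refine (Finset.sum_subset (Finset.range_mono h) fun l _ hln => ?_).ge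
    simp only [Finset.mem_range] at hln
    simp [F, hln]

lemma rank_rectDiagonal_le {m n q : ℕ} {σ : ℕ → ℝ} (hσ : ∀ i, q ≤ i → σ i = 0) :
    (rectDiagonal m n σ).rank ≤ q := by
  have h : rectDiagonal m n σ = rectDiagonal m q σ * rectDiagonal q n (fun _ => 1) := by
    ext i j
    change _ = (rectDiagonal m q σ *ᵥ fun l => rectDiagonal q n (fun _ => 1) l j) i
    rcases lt_or_ge (i : ℕ) q with hi | hi
    · rw [rectDiagonal_mulVec_of_lt _ _ _ hi]
      simp [rectDiagonal]
    · rw [rectDiagonal_mulVec_of_le _ _ _ hi]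
      simp [rectDiagonal, hσ i hi]
  rw [h]
  exact (rank_mul_le_left _ _).trans (rank_le_width _)

lemma transpose_mul_self_eq_one_of_injective {n r : ℕ} {f : Fin r → Fin n}
    (hf : Function.Injective f) {S : Matrix (Fin n) (Fin r) ℝ}
    (hS : S = Matrix.of fun i j => if i = f j then (1 : ℝ) else 0) : Sᵀ * S = 1 := by
  ext i j
  simp [hS, mul_apply, one_apply, hf.eq_iff, eq_comm]

/-- if `A = U Σ Vᵀ` is a singular value decomposition (`U`, `V` orthogonal,
`Σ` rectangular diagonal with non-increasing nonnegative entries `σ`), `S` is a column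
sampling matrix (columns are distinct standard basis vectors), `C = A S`, and
`0 < k ≤ rank A`, then `‖C C⁺ U_k‖_F² ≥ ‖V_kᵀ S‖_F²`.  Here `‖C C⁺ U_k‖_F²` is the sum of
the squared norms of the first `k` columns of `C C⁺ U`, and `‖V_kᵀ S‖_F²` is the sum of the
squared norms of the first `k` rows of `Vᵀ S`. -/
theorem stmt0 {m n r : ℕ} (k : ℕ)
    (A : Matrix (Fin m) (Fin n) ℝ)
    (U : Matrix (Fin m) (Fin m) ℝ) (V : Matrix (Fin n) (Fin n) ℝ)
    (σ : ℕ → ℝ)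
    (hU : Uᵀ * U = 1) (hV : Vᵀ * V = 1)
    (hσ_nonneg : ∀ i, 0 ≤ σ i)
    (hσ_mono : ∀ i j : ℕ, i ≤ j → σ j ≤ σ i)
    (hA : A = U * (Matrix.of fun (i : Fin m) (j : Fin n) =>
        if (i : ℕ) = (j : ℕ) then σ i else 0) * Vᵀ)
    (hk_pos : 0 < k) (hk_rank : k ≤ A.rank)
    (f : Fin r → Fin n) (hf : Function.Injective f)
    (S : Matrix (Fin n) (Fin r) ℝ)
    (hS : S = Matrix.of fun i j => if i = f j then (1 : ℝ) else 0)
    (C : Matrix (Fin m) (Fin r) ℝ) (hC : C = A * S)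
    (Cp : Matrix (Fin r) (Fin m) ℝ) (hCp : IsMoorePenrose C Cp) :
    ∑ i ∈ Finset.univ.filter (fun i : Fin m => (i : ℕ) < k),
        ∑ l, ((C * Cp * U) l i) ^ 2
      ≥ ∑ i ∈ Finset.univ.filter (fun i : Fin n => (i : ℕ) < k),
        ∑ j, ((Vᵀ * S) i j) ^ 2 := by
  change A = U * rectDiagonal m n σ * Vᵀ at hA
  have hkm : k ≤ m := hk_rank.trans (rank_le_height A)
  have hkn : k ≤ n := hk_rank.trans (rank_le_width A)
  have hs : 0 < σ (k - 1) := by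
    refine lt_of_le_of_ne (hσ_nonneg _) fun h0 => ?_
    have hz : ∀ i, k - 1 ≤ i → σ i = 0 := fun i hi =>
      le_antisymm (h0 ▸ hσ_mono _ _ hi) (hσ_nonneg i)
    have hle : A.rank ≤ k - 1 := by
      rw [hA]
      exact (rank_mul_le_left _ _).trans ((rank_mul_le_right _ _).trans (rank_rectDiagonal_le hz))
    lia
  set W := Vᵀ * S with hWdef
  have hW : Wᵀ * W = 1 := by
    rw [hWdef, transpose_mul, transpose_transpose, Matrix.mul_assoc, ← Matrix.mul_assoc V,
      mul_eq_one_comm.mp hV, Matrix.one_mul, transpose_mul_self_eq_one_of_injective hf hS]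
  have hCW : C = U * (rectDiagonal m n σ * W) := by
    rw [hC, hA, hWdef]
    simp only [Matrix.mul_assoc]
  obtain ⟨hPC, -, hPsymm, -⟩ := hCp
  let t : ℝ := σ (k - 1) ^ 2
  have ht : 0 < t := pow_pos hs 2
  let c : Fin n → ℝ := fun j => if (j : ℕ) < k then σ j ^ 2 else t
  have hct (j : Fin n) : t ≤ c j := by
    simp only [c]
    split_ifs with hj
    · exact pow_le_pow_left₀ hs.le (hσ_mono _ _ (by lia)) 2
    · exact le_rfl
  have hcσ (j : Fin n) : σ j ^ 2 ≤ c j := by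
    simp only [c]
    split_ifs with hj
    · exact le_rfl
    · exact pow_le_pow_left₀ (hσ_nonneg _) (hσ_mono _ _ (by lia)) 2
  have hdet := (isUnit_iff_isUnit_det _).mp (isUnit_weightedGram hW ht hct)
  have hquad := dotProduct_weightedGram_mulVec W c
  have hRle := weightedGram_inv_dotProduct_le hW ht hct
  have hRsum := sum_mul_weightedGram_inv_dotProduct hW ht hct
  set Y := Wᵀ * diagonal c * W
  have hnorm (x : Fin r → ℝ) : (C *ᵥ x) ⬝ᵥ (C *ᵥ x) ≤ x ⬝ᵥ (Y *ᵥ x) := by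
    have h1 : (C *ᵥ x) ⬝ᵥ (C *ᵥ x)
        = (rectDiagonal m n σ *ᵥ (W *ᵥ x)) ⬝ᵥ (rectDiagonal m n σ *ᵥ (W *ᵥ x)) := by
      rw [hCW, ← mulVec_mulVec, ← mulVec_mulVec, dotProduct_mulVec, ← mulVec_transpose,
        mulVec_mulVec, hU, one_mulVec]
    rw [h1, hquad]
    refine (rectDiagonal_mulVec_dotProduct_self_le σ _).trans ?_
    gcongr with j
    exact hcσ j
  have hcol (i : Fin k) :
      c (Fin.castLE hkn i) * (W (Fin.castLE hkn i) ⬝ᵥ (Y⁻¹ *ᵥ W (Fin.castLE hkn i)))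
        ≤ ∑ l, ((C * Cp * U) l (Fin.castLE hkm i)) ^ 2 := by
    set w := W (Fin.castLE hkn i) with hw
    set z := Y⁻¹ *ᵥ w with hz
    have hYz : Y *ᵥ z = w := by rw [hz, mulVec_mulVec, mul_nonsing_inv _ hdet, one_mulVec]
    have hproj := two_mul_dotProduct_sub_le_of_projection hPsymm hPC
      (fun l => U l (Fin.castLE hkm i)) (σ i • z)
    have hu : (fun l => U l (Fin.castLE hkm i)) ⬝ᵥ (C *ᵥ z) = σ i * (w ⬝ᵥ z) := by
      change (Uᵀ *ᵥ (C *ᵥ z)) (Fin.castLE hkm i) = _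
      rw [hCW, ← mulVec_mulVec, mulVec_mulVec, hU, one_mulVec, ← mulVec_mulVec,
        rectDiagonal_mulVec_of_lt _ _ _ (by simpa using i.2.trans_le hkn)]
      rfl
    have hn := hnorm z
    rw [hYz, dotProduct_comm z w] at hn
    simp only [mulVec_smul, dotProduct_smul, smul_dotProduct, smul_eq_mul, hu] at hproj
    have hci : c (Fin.castLE hkn i) = σ i ^ 2 := by simp [c]
    rw [hci]
    refine le_trans ?_ hproj
    nlinarith [mul_le_mul_of_nonneg_left hn (sq_nonneg (σ i))]
  have hhead : ∑ i ∈ Finset.univ.filter (fun i : Fin n => (i : ℕ) < k), W i ⬝ᵥ W i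
      ≤ ∑ i ∈ Finset.univ.filter (fun i : Fin n => (i : ℕ) < k),
        c i * (W i ⬝ᵥ (Y⁻¹ *ᵥ W i)) := by
    rw [← Finset.sum_filter_add_sum_filter_not univ (fun i : Fin n => (i : ℕ) < k),
      ← Finset.sum_filter_add_sum_filter_not univ (fun i : Fin n => (i : ℕ) < k)
        (fun i => W i ⬝ᵥ W i)] at hRsum
    have htail : ∑ i ∈ Finset.univ.filter (fun i : Fin n => ¬ (i : ℕ) < k),
          c i * (W i ⬝ᵥ (Y⁻¹ *ᵥ W i))
        ≤ ∑ i ∈ Finset.univ.filter (fun i : Fin n => ¬ (i : ℕ) < k), W i ⬝ᵥ W i := by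
      refine Finset.sum_le_sum fun i hi => ?_
      have hci : c i = t := if_neg (Finset.mem_filter.mp hi).2
      rw [hci]
      exact hRle (W i)
    linarith
  calc ∑ i ∈ Finset.univ.filter (fun i : Fin n => (i : ℕ) < k), ∑ j, (W i j) ^ 2
      = ∑ i ∈ Finset.univ.filter (fun i : Fin n => (i : ℕ) < k), W i ⬝ᵥ W i := by
        simp only [dotProduct, sq]
    _ ≤ _ := hhead
    _ = _ := sum_filter_val_lt_eq_sum_castLE hkn _
    _ ≤ _ := Finset.sum_le_sum fun i _ => hcol i
    _ = _ :=
        (sum_filter_val_lt_eq_sum_castLE hkm fun i => ∑ l, ((C * Cp * U) l i) ^ 2).symm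
end

section
/- Let X ∈ ℝ^{n×k} have rank k, let α ≥ 0, and let D ∈ ℝ^{n×n} be the diagonal matrix with D_{ii} = α and D_{jj} = 1 for all j ≠ i. Write x_jᵀ for the j-th row of X and assume 1 + (α² − 1)ℓ_i(X) ≠ 0 and that DX has rank k. Then for every j ≠ i, ℓ_j(DX) = ℓ_j(X) − (α² − 1)(x_jᵀ(XᵀX)^{-1}x_i)² / (1 + (α² − 1)ℓ_i(X)). -/
open Matrix BigOperators Finset

/-- The pseudoinverse of a matrix of full column rank is `(MᵀM)⁻¹Mᵀ`; this is its leverage form. -/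
theorem IsMoorePenrose.mul_apply_self {n k : ℕ} {M : Matrix (Fin n) (Fin k) ℝ}
    {P : Matrix (Fin k) (Fin n) ℝ} (h : IsMoorePenrose M P) (hM : IsUnit (Mᵀ * M).det)
    (j : Fin n) : (M * P) j j = M j ⬝ᵥ ((Mᵀ * M)⁻¹ *ᵥ M j) := by
  have h1 : Mᵀ * M * P = Mᵀ := by
    rw [Matrix.mul_assoc, ← h.2.2.1, ← Matrix.transpose_mul, h.1]
  have h2 : P = (Mᵀ * M)⁻¹ * Mᵀ := by
    rw [← Matrix.nonsing_inv_mul_cancel_left _ P hM, h1]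
  rw [h2]
  rfl

theorem isUnit_det_transpose_mul_self {n k : ℕ} {M : Matrix (Fin n) (Fin k) ℝ}
    (h : M.rank = k) : IsUnit (Mᵀ * M).det := by
  rw [← Matrix.isUnit_iff_isUnit_det, ← Matrix.mulVec_surjective_iff_isUnit]
  have hr : (Mᵀ * M).rank = k := by rw [Matrix.rank_transpose_mul_self, h]
  have ht : LinearMap.range (Mᵀ * M).mulVecLin = ⊤ :=
    Submodule.eq_top_of_finrank_eq (by simpa [Matrix.rank] using hr)
  exact LinearMap.range_eq_top.mp ht

/-- Scaling row `i` by `α` perturbs the Gram matrix by a multiple of a rank-one matrix. -/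
theorem gram_diagonal_mul {n k : ℕ} (X : Matrix (Fin n) (Fin k) ℝ) (i : Fin n) (α : ℝ) :
    (diagonal (fun t => if t = i then α else 1) * X)ᵀ *
        (diagonal (fun t => if t = i then α else 1) * X)
      = Xᵀ * X + (α ^ 2 - 1) • vecMulVec (X i) (X i) := by
  ext a b
  have hsum : ∀ t, (if t = i then α else 1) * X t a * ((if t = i then α else 1) * X t b)
      = X t a * X t b + if t = i then (α ^ 2 - 1) * (X i a * X i b) else 0 := by
    intro t
    split_ifs with ht
    · subst ht; ring
    · ring
  rw [Matrix.mul_apply]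
  simp only [Matrix.transpose_apply, Matrix.diagonal_mul, hsum]
  simp [Matrix.mul_apply, Matrix.vecMulVec_apply, Finset.sum_add_distrib]

/-- The quadratic form of the Sherman–Morrison formula for a symmetric matrix. -/
theorem dotProduct_inv_add_smul_vecMulVec {k : ℕ} {G : Matrix (Fin k) (Fin k) ℝ}
    (hsymm : Gᵀ = G) (hG : IsUnit G.det) (c : ℝ) (u v : Fin k → ℝ)
    (hH : IsUnit (G + c • vecMulVec u u).det) (hc : 1 + c * (u ⬝ᵥ (G⁻¹ *ᵥ u)) ≠ 0) :
    v ⬝ᵥ ((G + c • vecMulVec u u)⁻¹ *ᵥ v)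
      = v ⬝ᵥ (G⁻¹ *ᵥ v) - c * (v ⬝ᵥ (G⁻¹ *ᵥ u)) ^ 2 / (1 + c * (u ⬝ᵥ (G⁻¹ *ᵥ u))) := by
  have hswap : u ⬝ᵥ (G⁻¹ *ᵥ v) = v ⬝ᵥ (G⁻¹ *ᵥ u) := by
    rw [Matrix.dotProduct_mulVec, ← Matrix.mulVec_transpose, Matrix.transpose_nonsing_inv, hsymm,
      dotProduct_comm]
  have hcancel : ∀ w : Fin k → ℝ, G *ᵥ (G⁻¹ *ᵥ w) = w := fun w => by
    rw [Matrix.mulVec_mulVec, Matrix.mul_nonsing_inv _ hG, Matrix.one_mulVec]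
  set s := c * (v ⬝ᵥ (G⁻¹ *ᵥ u)) / (1 + c * (u ⬝ᵥ (G⁻¹ *ᵥ u))) with hs
  have hz : (G + c • vecMulVec u u) *ᵥ (G⁻¹ *ᵥ v - s • (G⁻¹ *ᵥ u)) = v := by
    ext a
    simp only [Matrix.add_mulVec, Matrix.smul_mulVec, Matrix.vecMulVec_mulVec, Matrix.mulVec_sub,
      Matrix.mulVec_smul, hcancel, hswap, Pi.add_apply, Pi.sub_apply, Pi.smul_apply, smul_eq_mul,
      MulOpposite.smul_eq_mul_unop, MulOpposite.unop_op]
    rw [hs]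
    field_simp
    ring
  have hinv : (G + c • vecMulVec u u)⁻¹ *ᵥ v = G⁻¹ *ᵥ v - s • (G⁻¹ *ᵥ u) := by
    conv_lhs => rw [← hz]
    rw [Matrix.mulVec_mulVec, Matrix.nonsing_inv_mul _ hH, Matrix.one_mulVec]
  rw [hinv, dotProduct_sub, dotProduct_smul, smul_eq_mul, hs]
  ring


/-- change of off-diagonal statistical leverages under scaling of one row.
The statistical leverage `ℓ_j(M)` is the `j`-th diagonal entry of `M * M⁺`, formalized here
via a Moore–Penrose pseudoinverse witness. -/
theorem stmt1 {n k : ℕ}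
    (X : Matrix (Fin n) (Fin k) ℝ) (hXrank : X.rank = k)
    (i : Fin n) (α : ℝ) (hα : 0 ≤ α)
    (D : Matrix (Fin n) (Fin n) ℝ)
    (hD : D = Matrix.diagonal (fun t => if t = i then α else 1))
    (Q : Matrix (Fin k) (Fin n) ℝ) (hQ : IsMoorePenrose X Q)
    (P : Matrix (Fin k) (Fin n) ℝ) (hP : IsMoorePenrose (D * X) P)
    (hdenom : 1 + (α ^ 2 - 1) * (X * Q) i i ≠ 0)
    (hDXrank : (D * X).rank = k) :
    ∀ j : Fin n, j ≠ i →
      ((D * X) * P) j j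
        = (X * Q) j j
          - (α ^ 2 - 1) * (X j ⬝ᵥ ((Xᵀ * X)⁻¹ *ᵥ X i)) ^ 2
              / (1 + (α ^ 2 - 1) * (X * Q) i i) := by
  intro j hj
  have hX := isUnit_det_transpose_mul_self hXrank
  have hDX := isUnit_det_transpose_mul_self hDXrank
  have hrow : (D * X) j = X j := by
    ext a
    simp [hD, Matrix.diagonal_mul, hj]
  have hgram : (D * X)ᵀ * (D * X) = Xᵀ * X + (α ^ 2 - 1) • vecMulVec (X i) (X i) := by
    rw [hD, gram_diagonal_mul]
  rw [hQ.mul_apply_self hX] at hdenom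
  rw [hP.mul_apply_self hDX, hQ.mul_apply_self hX, hQ.mul_apply_self hX, hrow, hgram]
  rw [hgram] at hDX
  exact dotProduct_inv_add_smul_vecMulVec (by simp [Matrix.transpose_mul]) hX _ _ _ hDX hdenom
end

section
/- Let X ∈ ℝ^{n×k} have rank k, let α ≥ 0, and let D ∈ ℝ^{n×n} be the diagonal matrix with D_{ii} = α and D_{jj} = 1 for all j ≠ i. Assume 1 + (α² − 1)ℓ_i(X) ≠ 0 and that DX has rank k. Then ℓ_i(DX) = α²ℓ_i(X) / (1 + (α² − 1)ℓ_i(X)). -/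
open Matrix BigOperators Finset

/-- A generalized inverse of a matrix of full column rank is a left inverse. -/
theorem mul_eq_one_of_rank_eq {n k : ℕ} {M : Matrix (Fin n) (Fin k) ℝ}
    {P : Matrix (Fin k) (Fin n) ℝ} (hrank : M.rank = k) (h : M * P * M = M) : P * M = 1 := by
  have hli : LinearIndependent ℝ M.col := by
    rw [linearIndependent_iff_card_eq_finrank_span, Fintype.card_fin, Set.finrank,
      ← Matrix.rank_eq_finrank_span_cols, hrank]
  have hinj : Function.Injective M.mulVec := Matrix.mulVec_injective_iff.2 hli
  refine Matrix.ext_of_mulVec_single fun j => hinj ?_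
  rw [Matrix.mulVec_mulVec, ← Matrix.mul_assoc, h, Matrix.one_mulVec]

/-- change of the `i`-th statistical leverage under scaling of the `i`-th row.
The statistical leverage `ℓ_i(M)` is the `i`-th diagonal entry of `M * M⁺`, formalized here
via a Moore–Penrose pseudoinverse witness. -/
theorem stmt2 {n k : ℕ}
    (X : Matrix (Fin n) (Fin k) ℝ) (hXrank : X.rank = k)
    (i : Fin n) (α : ℝ) (hα : 0 ≤ α)
    (D : Matrix (Fin n) (Fin n) ℝ)
    (hD : D = Matrix.diagonal (fun t => if t = i then α else 1))
    (Q : Matrix (Fin k) (Fin n) ℝ) (hQ : IsMoorePenrose X Q)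
    (P : Matrix (Fin k) (Fin n) ℝ) (hP : IsMoorePenrose (D * X) P)
    (hdenom : 1 + (α ^ 2 - 1) * (X * Q) i i ≠ 0)
    (hDXrank : (D * X).rank = k) :
    ((D * X) * P) i i
      = α ^ 2 * (X * Q) i i / (1 + (α ^ 2 - 1) * (X * Q) i i) := by
  obtain ⟨hQ1, -, hQ3, -⟩ := hQ
  obtain ⟨hP1, hP2, hP3, -⟩ := hP
  have hPDX : P * (D * X) = 1 := mul_eq_one_of_rank_eq hDXrank hP1
  have hDt : Dᵀ = D := by rw [hD, Matrix.diagonal_transpose]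
  have hPfac : P * Pᵀ * Xᵀ * D = P := by
    calc P * Pᵀ * Xᵀ * D = P * (D * X * P)ᵀ := by
          simp only [Matrix.transpose_mul, hDt, Matrix.mul_assoc]
      _ = P := by rw [hP3, ← Matrix.mul_assoc, hP2]
  have hXtH : Xᵀ * (X * Q) = Xᵀ := by
    rw [← hQ3, ← Matrix.transpose_mul, hQ1]
  set H := X * Q with hH
  obtain ⟨K, hK⟩ : ∃ K, K = X * (P * Pᵀ * Xᵀ) := ⟨_, rfl⟩
  have hKH : K * H = K := by
    rw [hK, Matrix.mul_assoc, Matrix.mul_assoc, hXtH]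
  have hKD : K * D = X * P := by rw [hK, Matrix.mul_assoc, hPfac]
  have hKDDH : K * (D * D * H) = H := by
    calc K * (D * D * H) = K * D * (D * X) * Q := by simp only [hH, Matrix.mul_assoc]
      _ = X * (P * (D * X)) * Q := by rw [hKD, Matrix.mul_assoc X]
      _ = H := by rw [hPDX, Matrix.mul_one]
  have hDD : D * D = 1 + Matrix.single i i (α ^ 2 - 1) := by
    rw [hD, Matrix.diagonal_mul_diagonal, ← Matrix.diagonal_single, ← Matrix.diagonal_one,
      Matrix.diagonal_add]
    congr 1
    ext t
    by_cases ht : t = i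
    · subst ht
      simp
      ring
    · simp [ht]
  have hG : ((D * X) * P) i i = α ^ 2 * K i i := by
    rw [Matrix.mul_assoc, ← hKD, hD, Matrix.diagonal_mul, Matrix.mul_diagonal]
    simp
    ring
  have hKey : H i i = K i i + K i i * ((α ^ 2 - 1) * H i i) := by
    have h := congrFun (congrFun hKDDH i) i
    rw [hDD, Matrix.add_mul, Matrix.one_mul, Matrix.mul_add, hKH, Matrix.add_apply,
      ← Matrix.mul_assoc, Matrix.mul_apply] at h
    simpa [Matrix.mul_apply, Matrix.single_apply, ite_and, mul_assoc]
      using h.symm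
  rw [hG, eq_div_iff hdenom]
  linear_combination (-α ^ 2) * hKey
end

section
/- Let X ∈ ℝ^{n×k} have rank k, let α ≥ 1, and let D ∈ ℝ^{n×n} be the diagonal matrix with D_{ii} = α and D_{jj} = 1 for all j ≠ i. Then ℓ_i(DX) ≥ ℓ_i(X), and ℓ_j(DX) ≤ ℓ_j(X) for every j ≠ i. -/
open Matrix BigOperators Finset

/-- A diagonal weight that differs from `1` only at `i` perturbs a matrix product
by a rank-one term. -/
lemma mul_diagonal_ite_mul_apply {m : Type*} [Fintype m] [DecidableEq m]
    (A B : Matrix m m ℝ) (i : m) (c : ℝ) (a b : m) :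
    (A * Matrix.diagonal (fun t => if t = i then c else 1) * B) a b =
      (A * B) a b + (c - 1) * (A a i * B i b) := by
  have h : ∀ t, A a t * (if t = i then c else 1) * B t b =
      A a t * B t b + if t = i then (c - 1) * (A a t * B t b) else 0 := by
    intro t
    split_ifs <;> ring
  rw [Matrix.mul_apply, Matrix.mul_apply]
  simp only [Matrix.mul_diagonal, h, Finset.sum_add_distrib, Finset.sum_ite_eq',
    Finset.mem_univ, if_true]

/-- Comparison of the entries of the projections onto the column spaces of `X` and of `D * X`,
where `D` multiplies row `i` by `α`. -/
lemma IsMoorePenrose.projection_scale_row_apply {m l : Type*} [Fintype m] [DecidableEq m]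
    [Fintype l] {X : Matrix m l ℝ} {Q P : Matrix l m ℝ} {i : m} {α : ℝ} (hα : α ≠ 0)
    (hQ : IsMoorePenrose X Q)
    (hP : IsMoorePenrose (Matrix.diagonal (fun t => if t = i then α else 1) * X) P) (a b : m) :
    (α - α⁻¹) * ((Matrix.diagonal (fun t => if t = i then α else 1) * X * P) a i *
        (X * Q) i b) =
      (if a = i then α else 1) * (X * Q) a b -
        (if b = i then α⁻¹ else 1) *
          (Matrix.diagonal (fun t => if t = i then α else 1) * X * P) a b := by
  obtain ⟨hQ1, -, hQ3, -⟩ := hQ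
  obtain ⟨hP1, -, hP3, -⟩ := hP
  set D : Matrix m m ℝ := Matrix.diagonal (fun t => if t = i then α else 1) with hD
  set E : Matrix m m ℝ := Matrix.diagonal (fun t => if t = i then α⁻¹ else 1) with hE
  have hED : E * D = 1 := by
    rw [hE, hD, Matrix.diagonal_mul_diagonal, ← Matrix.diagonal_one]
    congr 1
    funext t
    split_ifs <;> simp [hα]
  have hEDX : E * (D * X * P) = X * P := by
    rw [Matrix.mul_assoc D, ← Matrix.mul_assoc E, hED, Matrix.one_mul]
  have h1 : (D * X * P) * D * (X * Q) = D * (X * Q) := by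
    rw [← Matrix.mul_assoc _ X Q, Matrix.mul_assoc _ D X, hP1, Matrix.mul_assoc]
  have h2 : (X * Q) * E * (D * X * P) = E * (D * X * P) := by
    rw [Matrix.mul_assoc, hEDX, ← Matrix.mul_assoc, hQ1]
  have h3 : (D * X * P) * E * (X * Q) = (D * X * P) * E := by
    have h := congrArg Matrix.transpose h2
    rwa [Matrix.transpose_mul (X * Q * E), Matrix.transpose_mul (X * Q) E,
      Matrix.transpose_mul E, hP3, hQ3, hE, Matrix.diagonal_transpose, ← hE,
      ← Matrix.mul_assoc] at h
  have e1 := congrFun (congrFun h1 a) b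
  have e2 := congrFun (congrFun h3 a) b
  generalize D * X * P = H' at *
  rw [hD, mul_diagonal_ite_mul_apply, Matrix.diagonal_mul] at e1
  rw [hE, mul_diagonal_ite_mul_apply, Matrix.mul_diagonal] at e2
  linear_combination e1 - e2

/-- A diagonal entry of a symmetric idempotent matrix dominates its own square. -/
lemma sq_diag_le_of_symm_idempotent {m : Type*} [Fintype m] {H : Matrix m m ℝ}
    (hs : Hᵀ = H) (hi : H * H = H) (i : m) : H i i ^ 2 ≤ H i i := by
  have h : ∑ t, H i t ^ 2 = H i i := by
    conv_rhs => rw [← hi, Matrix.mul_apply]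
    refine Finset.sum_congr rfl fun t _ => ?_
    rw [sq, ← Matrix.transpose_apply H i t, hs]
  calc H i i ^ 2 ≤ ∑ t, H i t ^ 2 :=
        Finset.single_le_sum (f := fun t => H i t ^ 2) (fun t _ => sq_nonneg _)
          (Finset.mem_univ i)
    _ = H i i := h

/-- scaling the `i`-th row by `α ≥ 1` does not decrease the `i`-th statistical
leverage and does not increase any other statistical leverage. The statistical leverage
`ℓ_j(M)` is the `j`-th diagonal entry of `M * M⁺`, formalized here via Moore–Penrose
pseudoinverse witnesses. -/
theorem stmt3 {n k : ℕ}
    (X : Matrix (Fin n) (Fin k) ℝ) (hXrank : X.rank = k)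
    (i : Fin n) (α : ℝ) (hα : 1 ≤ α)
    (D : Matrix (Fin n) (Fin n) ℝ)
    (hD : D = Matrix.diagonal (fun t => if t = i then α else 1))
    (Q : Matrix (Fin k) (Fin n) ℝ) (hQ : IsMoorePenrose X Q)
    (P : Matrix (Fin k) (Fin n) ℝ) (hP : IsMoorePenrose (D * X) P) :
    ((D * X) * P) i i ≥ (X * Q) i i ∧
      ∀ j : Fin n, j ≠ i → ((D * X) * P) j j ≤ (X * Q) j j := by
  subst hD
  have hα0 : 0 < α := by linarith
  have key := IsMoorePenrose.projection_scale_row_apply hα0.ne' hQ hP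
  have hsq : (X * Q) i i ^ 2 ≤ (X * Q) i i :=
    sq_diag_le_of_symm_idempotent hQ.2.2.1 (by rw [← Matrix.mul_assoc, hQ.1]) i
  have hsymm : ∀ j, (X * Q) i j = (X * Q) j i := fun j => by
    rw [← Matrix.transpose_apply (X * Q) j i, hQ.2.2.1]
  generalize Matrix.diagonal (fun t => if t = i then α else 1) * X * P = H' at *
  generalize X * Q = H at *
  have hh : 0 ≤ H i i := (sq_nonneg _).trans hsq
  have hinv : α⁻¹ ≤ 1 := inv_le_one_of_one_le₀ hα
  have hinv0 : 0 < α⁻¹ := inv_pos.mpr hα0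
  have hc : 0 ≤ α - α⁻¹ := by linarith
  have hpos : 0 < α⁻¹ + (α - α⁻¹) * H i i := by positivity
  constructor
  · have e := key i i
    simp only [if_true] at e
    have hd : (H' i i - H i i) * (α⁻¹ + (α - α⁻¹) * H i i) =
        (α - α⁻¹) * (H i i - H i i ^ 2) := by
      linear_combination e
    have hnn : 0 ≤ (H' i i - H i i) * (α⁻¹ + (α - α⁻¹) * H i i) := by
      rw [hd]
      exact mul_nonneg hc (sub_nonneg.mpr hsq)
    exact sub_nonneg.mp (nonneg_of_mul_nonneg_left hnn hpos)
  · intro j hj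
    have e1 := key j j
    have e2 := key j i
    simp only [if_true, if_neg hj, one_mul] at e1 e2
    have h2 : H j i = H' j i * (α⁻¹ + (α - α⁻¹) * H i i) := by linear_combination -e2
    rw [hsymm j, h2] at e1
    have hnn : 0 ≤ (α - α⁻¹) * (H' j i ^ 2 * (α⁻¹ + (α - α⁻¹) * H i i)) := by positivity
    linarith
end

section
/- Let A ∈ ℝ^{m×n} have full singular value decomposition A = UΣVᵀ with U ∈ ℝ^{m×m} and V ∈ ℝ^{n×n} orthogonal, let S ∈ ℝ^{n×r} be a column sampling matrix, set C = AS, and let k ≤ m. Then ‖CC⁺U_k‖_F² equals the sum of the first k diagonal entries of the projection matrix ΣVᵀS(ΣVᵀS)⁺; equivalently, ‖CC⁺U_k‖_F² = ‖ΣVᵀS(ΣVᵀS)⁺ P_k‖_F², where P_k ∈ ℝ^{m×k} is the matrix whose columns are the first k standard basis vectors of ℝ^m. -/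
open Matrix BigOperators Finset

/-- Squared Frobenius norm of a real matrix. -/
def frobSq {a b : Type*} [Fintype a] [Fintype b] (M : Matrix a b ℝ) : ℝ :=
  ∑ i, ∑ j, (M i j) ^ 2

/-- `M * P` does not depend on the symmetric-projector inner inverse `P` of `M`. -/
theorem Matrix.mul_eq_mul_of_symmetric_innerInverse {a b : Type*} [Fintype a] [Fintype b]
    {M : Matrix a b ℝ} {P Q : Matrix b a ℝ}
    (hP : M * P * M = M) (hPs : (M * P)ᵀ = M * P)
    (hQ : M * Q * M = M) (hQs : (M * Q)ᵀ = M * Q) : M * P = M * Q := by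
  have h₁ : M * Q * (M * P) = M * P := by rw [← Matrix.mul_assoc, hQ]
  have h₂ : M * P * (M * Q) = M * Q := by rw [← Matrix.mul_assoc, hP]
  calc M * P = (M * Q * (M * P))ᵀ := by rw [h₁, hPs]
    _ = M * Q := by rw [Matrix.transpose_mul, hPs, hQs, h₂]

/-- The range projector of `U * N`, for `U` with orthonormal columns, is the conjugate by `U` of
the range projector of `N`. -/
theorem IsMoorePenrose.mul_eq_conj {a b c : Type*} [Fintype a] [Fintype b] [Fintype c]
    [DecidableEq c] {U : Matrix a c ℝ} (hU : Uᵀ * U = 1) {N : Matrix c b ℝ}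
    {P : Matrix b a ℝ} {Q : Matrix b c ℝ}
    (hP : IsMoorePenrose (U * N) P) (hQ : IsMoorePenrose N Q) :
    U * N * P = U * (N * Q) * Uᵀ := by
  have hE : U * N * (Q * Uᵀ) = U * (N * Q) * Uᵀ := by simp only [Matrix.mul_assoc]
  rw [← hE]
  refine Matrix.mul_eq_mul_of_symmetric_innerInverse hP.1 hP.2.2.1 ?_ ?_
  · calc U * N * (Q * Uᵀ) * (U * N) = U * (N * Q * ((Uᵀ * U) * N)) := by
          simp only [Matrix.mul_assoc]
      _ = U * N := by rw [hU, Matrix.one_mul, hQ.1]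
  · rw [hE, Matrix.transpose_mul, Matrix.transpose_mul, Matrix.transpose_transpose, hQ.2.2.1,
      Matrix.mul_assoc U]

theorem Matrix.sum_sq_col_eq_transpose_mul_self {a b : Type*} [Fintype a]
    (M : Matrix a b ℝ) (i : b) : ∑ l, M l i ^ 2 = (Mᵀ * M) i i := by
  simp only [Matrix.mul_apply, Matrix.transpose_apply, sq]

theorem IsMoorePenrose.transpose_mul_self {a b : Type*} [Fintype a] [Fintype b]
    {M : Matrix a b ℝ} {P : Matrix b a ℝ} (h : IsMoorePenrose M P) :
    (M * P)ᵀ * (M * P) = M * P := by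
  rw [h.2.2.1, ← Matrix.mul_assoc, h.1]

theorem Fin.sum_filter_val_lt {k m : ℕ} (hk : k ≤ m) (g : Fin m → ℝ) :
    ∑ i ∈ Finset.univ.filter (fun i : Fin m => (i : ℕ) < k), g i
      = ∑ j : Fin k, g (Fin.castLE hk j) := by
  symm
  refine Finset.sum_bij (fun j _ => Fin.castLE hk j) ?_ ?_ ?_ ?_
  · intro j _
    simp
  · intro a _ b _ hab
    exact Fin.castLE_injective hk hab
  · intro i hi
    exact ⟨⟨i, (Finset.mem_filter.mp hi).2⟩, Finset.mem_univ _, rfl⟩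
  · intro j _
    rfl

/-- with a full SVD `A = U Σ Vᵀ` (`U`, `V` orthogonal, `Σ` rectangular diagonal
with non-increasing nonnegative entries), `S` a column sampling matrix, `C = A S`, and
`k ≤ m`: `‖C C⁺ U_k‖_F²` (the sum of squared norms of the first `k` columns of `C C⁺ U`)
equals the sum of the first `k` diagonal entries of the projector `Σ Vᵀ S (Σ Vᵀ S)⁺`, and
equals `‖Σ Vᵀ S (Σ Vᵀ S)⁺ P_k‖_F²` where `P_k` consists of the first `k` standard basis
vectors of `ℝ^m`. -/
theorem stmt5 {m n r : ℕ} (k : ℕ)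
    (A : Matrix (Fin m) (Fin n) ℝ)
    (U : Matrix (Fin m) (Fin m) ℝ) (V : Matrix (Fin n) (Fin n) ℝ)
    (σ : ℕ → ℝ)
    (hU : Uᵀ * U = 1) (hV : Vᵀ * V = 1)
    (hσ_nonneg : ∀ i, 0 ≤ σ i)
    (hσ_mono : ∀ i j : ℕ, i ≤ j → σ j ≤ σ i)
    (Sig : Matrix (Fin m) (Fin n) ℝ)
    (hSig : Sig = Matrix.of fun (i : Fin m) (j : Fin n) =>
        if (i : ℕ) = (j : ℕ) then σ i else 0)
    (hA : A = U * Sig * Vᵀ)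
    (hk : k ≤ m)
    (f : Fin r → Fin n) (hf : Function.Injective f)
    (S : Matrix (Fin n) (Fin r) ℝ)
    (hS : S = Matrix.of fun i j => if i = f j then (1 : ℝ) else 0)
    (C : Matrix (Fin m) (Fin r) ℝ) (hC : C = A * S)
    (Cp : Matrix (Fin r) (Fin m) ℝ) (hCp : IsMoorePenrose C Cp)
    (Gp : Matrix (Fin r) (Fin m) ℝ) (hGp : IsMoorePenrose (Sig * Vᵀ * S) Gp)
    (Pk : Matrix (Fin m) (Fin k) ℝ)
    (hPk : Pk = Matrix.of fun (i : Fin m) (j : Fin k) =>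
        if (i : ℕ) = (j : ℕ) then (1 : ℝ) else 0) :
    (∑ i ∈ Finset.univ.filter (fun i : Fin m => (i : ℕ) < k),
        ∑ l, ((C * Cp * U) l i) ^ 2)
      = (∑ i ∈ Finset.univ.filter (fun i : Fin m => (i : ℕ) < k),
          ((Sig * Vᵀ * S) * Gp) i i)
    ∧ (∑ i ∈ Finset.univ.filter (fun i : Fin m => (i : ℕ) < k),
        ∑ l, ((C * Cp * U) l i) ^ 2)
      = frobSq ((Sig * Vᵀ * S) * Gp * Pk) := by
  have hC' : C = U * (Sig * Vᵀ * S) := by rw [hC, hA]; simp only [Matrix.mul_assoc]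
  rw [hC'] at hCp
  have hproj : C * Cp * U = U * (Sig * Vᵀ * S * Gp) := by
    rw [hC', hCp.mul_eq_conj hU hGp, Matrix.mul_assoc, hU, Matrix.mul_one]
  have hcol (i : Fin m) : ∑ l, (Sig * Vᵀ * S * Gp) l i ^ 2 = (Sig * Vᵀ * S * Gp) i i := by
    rw [Matrix.sum_sq_col_eq_transpose_mul_self, hGp.transpose_mul_self]
  have hcolU (i : Fin m) : ∑ l, (C * Cp * U) l i ^ 2 = (Sig * Vᵀ * S * Gp) i i := by
    rw [hproj, Matrix.sum_sq_col_eq_transpose_mul_self, Matrix.transpose_mul, Matrix.mul_assoc,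
      ← Matrix.mul_assoc Uᵀ, hU, Matrix.one_mul, hGp.transpose_mul_self]
  have hPk_apply (M : Matrix (Fin m) (Fin m) ℝ) (l : Fin m) (j : Fin k) :
      (M * Pk) l j = M l (Fin.castLE hk j) := by
    have hiff (i : Fin m) : (i : ℕ) = (j : ℕ) ↔ i = Fin.castLE hk j := by
      simp [Fin.ext_iff]
    simp [hPk, Matrix.mul_apply, hiff]
  simp only [hcolU, true_and]
  rw [Fin.sum_filter_val_lt hk, frobSq, Finset.sum_comm]
  simp only [hPk_apply, hcol]
end

section
/- Let X ∈ ℝ^{n×r} satisfy XᵀX = I_r, set H = XXᵀ, let M ⊆ {1,…,n}, and for each i ∈ M let d_i ≥ 1, with d = max_{i∈M} d_i. Let D ∈ ℝ^{n×n} be the diagonal matrix with D_{ii} = d_i for i ∈ M and D_{ii} = 1 otherwise. Then for every index j ∉ M, the statistical leverage of the j-th row of DX satisfies ℓ_j(DX) ≥ H_{jj} − (d² − 1)·Σ_{i∈M} H_{ji}², and consequently ℓ_j(DX) ≥ H_{jj} − d²(1 − H_{jj}). -/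
open Matrix BigOperators Finset

/-- A symmetric idempotent `Q` fixing the columns of `B` satisfies
`Q j j ≥ 2 * B j j - ∑ i, (B i j) ^ 2`. -/
theorem two_mul_sub_sum_sq_le_of_isProj {n : Type*} [Fintype n] (Q B : Matrix n n ℝ)
    (hsymm : Qᵀ = Q) (hidem : Q * Q = Q) (hfix : Q * B = B) (j : n) :
    2 * B j j - ∑ i, (B i j) ^ 2 ≤ Q j j := by
  have hQ : ∑ i, (Q i j) ^ 2 = Q j j := by
    have h := congrFun (congrFun hidem j) j
    rw [Matrix.mul_apply] at h
    rw [← h]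
    refine Finset.sum_congr rfl fun i _ => ?_
    rw [show Q j i = Q i j from congrFun (congrFun hsymm i) j, sq]
  have hB : ∑ i, Q i j * B i j = B j j := by
    have h := congrFun (congrFun hfix j) j
    rw [Matrix.mul_apply] at h
    rw [← h]
    refine Finset.sum_congr rfl fun i _ => ?_
    rw [show Q j i = Q i j from congrFun (congrFun hsymm i) j]
  have hnonneg : 0 ≤ ∑ i, (Q i j - B i j) ^ 2 := Finset.sum_nonneg fun i _ => sq_nonneg _
  have hexp : ∑ i, (Q i j - B i j) ^ 2 =
      ∑ i, (Q i j) ^ 2 - 2 * ∑ i, Q i j * B i j + ∑ i, (B i j) ^ 2 := by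
    rw [Finset.mul_sum, ← Finset.sum_sub_distrib, ← Finset.sum_add_distrib]
    exact Finset.sum_congr rfl fun i _ => by ring
  linarith

/-- if `Xᵀ X = I`, `H = X Xᵀ`, `D` is diagonal with `D_{ii} = d_i ≥ 1` for
`i ∈ M` and `1` otherwise, and `d = max_{i∈M} d_i` (formalized as `sSup (d '' M)`), then
for every `j ∉ M` the statistical leverage `ℓ_j(D X)` (the `j`-th diagonal entry of
`(D X)(D X)⁺`, via a Moore–Penrose witness) satisfies
`ℓ_j(D X) ≥ H_{jj} − (d² − 1) Σ_{i∈M} H_{ji}²` and `ℓ_j(D X) ≥ H_{jj} − d² (1 − H_{jj})`. -/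
theorem stmt9 {n r : ℕ}
    (X : Matrix (Fin n) (Fin r) ℝ) (hX : Xᵀ * X = 1)
    (H : Matrix (Fin n) (Fin n) ℝ) (hH : H = X * Xᵀ)
    (M : Finset (Fin n)) (d : Fin n → ℝ) (hd : ∀ i ∈ M, 1 ≤ d i)
    (dmax : ℝ) (hdmax : dmax = sSup (d '' ↑M))
    (D : Matrix (Fin n) (Fin n) ℝ)
    (hD : D = Matrix.diagonal (fun i => if i ∈ M then d i else 1))
    (P : Matrix (Fin r) (Fin n) ℝ) (hP : IsMoorePenrose (D * X) P)
    (j : Fin n) (hj : j ∉ M) :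
    ((D * X) * P) j j ≥ H j j - (dmax ^ 2 - 1) * ∑ i ∈ M, (H j i) ^ 2 ∧
      ((D * X) * P) j j ≥ H j j - dmax ^ 2 * (1 - H j j) := by
  obtain ⟨h1, -, h3, -⟩ := hP
  have hHT : Hᵀ = H := by simp [hH]
  have hsymm (a b : Fin n) : H a b = H b a := congrFun (congrFun hHT b) a
  have hHH : H * H = H := by
    rw [hH, Matrix.mul_assoc, ← Matrix.mul_assoc Xᵀ, hX, Matrix.one_mul]
  have hrow : ∑ i, (H j i) ^ 2 = H j j := by
    have h := congrFun (congrFun hHH j) j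
    rw [Matrix.mul_apply] at h
    rw [← h]
    exact Finset.sum_congr rfl fun i _ => by rw [hsymm i j, sq]
  have hidem : (D * X * P) * (D * X * P) = D * X * P := by
    rw [← Matrix.mul_assoc, h1]
  have hfix : (D * X * P) * (D * H) = D * H := by
    rw [hH, ← Matrix.mul_assoc D, ← Matrix.mul_assoc, h1]
  have hlow := two_mul_sub_sum_sq_le_of_isProj _ _ h3 hidem hfix j
  have hDH (i : Fin n) : (D * H) i j = (if i ∈ M then d i else 1) * H j i := by
    rw [hD, Matrix.diagonal_mul, hsymm i j]
  have hsum : ∑ i, ((D * H) i j) ^ 2 ≤ H j j + (dmax ^ 2 - 1) * ∑ i ∈ M, (H j i) ^ 2 := by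
    have hM : ∑ i ∈ M, (H j i) ^ 2 = ∑ i, if i ∈ M then (H j i) ^ 2 else 0 := by simp
    conv_rhs => rw [← hrow]
    rw [hM, Finset.mul_sum, ← Finset.sum_add_distrib]
    refine Finset.sum_le_sum fun i _ => ?_
    rw [hDH]
    split_ifs with hi
    · have hle : d i ≤ dmax := by
        rw [hdmax]
        exact le_csSup (M.finite_toSet.image d).bddAbove ⟨i, hi, rfl⟩
      have hsq : d i ^ 2 ≤ dmax ^ 2 := pow_le_pow_left₀ (by linarith [hd i hi]) hle 2
      nlinarith [mul_le_mul_of_nonneg_right hsq (sq_nonneg (H j i))]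
    · simp
  have hfirst : H j j - (dmax ^ 2 - 1) * ∑ i ∈ M, (H j i) ^ 2 ≤ (D * X * P) j j := by
    rw [hDH j, if_neg hj] at hlow
    linarith
  have hS : ∑ i ∈ M, (H j i) ^ 2 + (H j j) ^ 2 ≤ H j j := by
    rw [add_comm, ← Finset.sum_insert (f := fun i => (H j i) ^ 2) hj]
    conv_rhs => rw [← hrow]
    exact Finset.sum_le_sum_of_subset_of_nonneg (Finset.subset_univ _) fun i _ _ => sq_nonneg _
  have hS0 : 0 ≤ ∑ i ∈ M, (H j i) ^ 2 := Finset.sum_nonneg fun i _ => sq_nonneg _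
  have hS1 : ∑ i ∈ M, (H j i) ^ 2 ≤ 1 - H j j := by nlinarith [sq_nonneg (H j j - 1)]
  refine ⟨hfirst, ?_⟩
  nlinarith [mul_le_mul_of_nonneg_left hS1 (sq_nonneg dmax)]
end

section
/- Let X ∈ ℝ^{n×r} satisfy XᵀX = I_r, let R ⊆ {1,…,n}, let j ∈ R, let α ≥ 1, and let D ∈ ℝ^{n×n} be the diagonal matrix with D_{jj} = α and D_{ii} = 1 for i ≠ j. Then Σ_{i∈R} ℓ_i(DX) ≥ Σ_{i∈R} ℓ_i(X); that is, scaling up a row whose index lies in R does not decrease the sum of the statistical leverages of the rows indexed by R. -/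
open Matrix BigOperators Finset

/-- The Moore–Penrose pseudoinverse of a matrix with a left inverse is a left inverse. -/
theorem IsMoorePenrose.mul_eq_one_of_left_inverse {a b : Type*} [Fintype a] [Fintype b]
    [DecidableEq b] {M : Matrix a b ℝ} {P L : Matrix b a ℝ} (hP : IsMoorePenrose M P)
    (hL : L * M = 1) : P * M = 1 := by
  have h := congrArg (L * ·) hP.1
  simpa only [Matrix.mul_assoc, ← Matrix.mul_assoc L M, hL, Matrix.one_mul] using h

/-- The Moore–Penrose pseudoinverse of a matrix with orthonormal columns is its transpose. -/
theorem IsMoorePenrose.eq_transpose {a b : Type*} [Fintype a] [Fintype b]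
    [DecidableEq b] {X : Matrix a b ℝ} {Q : Matrix b a ℝ} (hQ : IsMoorePenrose X Q)
    (hX : Xᵀ * X = 1) : Q = Xᵀ := by
  have hQX := hQ.mul_eq_one_of_left_inverse hX
  rw [← Matrix.one_mul Q, ← hX, Matrix.mul_assoc, ← hQ.2.2.1, ← transpose_mul,
    Matrix.mul_assoc, hQX, Matrix.mul_one]

/-- If `X` has orthonormal columns and no row is shrunk by `d`, then the leverage of a row
which `d` leaves unchanged does not increase. -/
theorem leverage_diagonal_mul_le {a b : Type*} [Fintype a] [Fintype b]
    [DecidableEq a] [DecidableEq b] {X : Matrix a b ℝ} (hX : Xᵀ * X = 1) {d : a → ℝ}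
    (hd : ∀ l, 1 ≤ d l) {P : Matrix b a ℝ} (hP : IsMoorePenrose (diagonal d * X) P)
    {i : a} (hi : d i = 1) :
    (diagonal d * X * P) i i ≤ (X * Xᵀ) i i := by
  set H := diagonal d * X * P with hH
  have hHe (l : a) : H l i = d l * (X * P) l i := by
    rw [hH, Matrix.mul_assoc, diagonal_mul]
  have hHH : Hᵀ * H = H := by
    rw [hP.2.2.1, hH, ← Matrix.mul_assoc, hP.1]
  have hsq : ∑ l, H l i ^ 2 = H i i := by
    conv_rhs => rw [← hHH]
    simp [Matrix.mul_apply, sq]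
  have hXP : ∑ l, (X * P) l i ^ 2 = ∑ k, P k i ^ 2 := by
    have h : (X * P)ᵀ * (X * P) = Pᵀ * P := by
      rw [transpose_mul, Matrix.mul_assoc, ← Matrix.mul_assoc Xᵀ, hX, Matrix.one_mul]
    have hi' := congrFun (congrFun h i) i
    rw [Matrix.mul_apply, Matrix.mul_apply] at hi'
    simpa only [transpose_apply, ← sq] using hi'
  have hle : ∑ k, P k i ^ 2 ≤ H i i := by
    rw [← hXP, ← hsq]
    refine Finset.sum_le_sum fun l _ => ?_
    rw [hHe, mul_pow]
    exact le_mul_of_one_le_left (sq_nonneg _) (one_le_pow₀ (hd l))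
  have hii : H i i = ∑ k, X i k * P k i := by rw [hHe, hi, one_mul, Matrix.mul_apply]
  have hXX : (X * Xᵀ) i i = ∑ k, X i k ^ 2 := by simp [Matrix.mul_apply, sq]
  have hnn : 0 ≤ ∑ k, (X i k - P k i) ^ 2 := Finset.sum_nonneg fun _ _ => sq_nonneg _
  have hexp : ∑ k, (X i k - P k i) ^ 2 =
      ∑ k, X i k ^ 2 - 2 * ∑ k, X i k * P k i + ∑ k, P k i ^ 2 := by
    rw [Finset.mul_sum, ← Finset.sum_sub_distrib, ← Finset.sum_add_distrib]
    exact Finset.sum_congr rfl fun k _ => by ring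
  linarith

/-- if `Xᵀ X = I`, `j ∈ R`, `α ≥ 1`, and `D` is diagonal with `D_{jj} = α`
and `1` elsewhere, then scaling up row `j` does not decrease the sum over `R` of the
statistical leverages (diagonal entries of `M M⁺`, via Moore–Penrose witnesses):
`Σ_{i∈R} ℓ_i(D X) ≥ Σ_{i∈R} ℓ_i(X)`. -/
theorem stmt10 {n r : ℕ}
    (X : Matrix (Fin n) (Fin r) ℝ) (hX : Xᵀ * X = 1)
    (R : Finset (Fin n)) (j : Fin n) (hj : j ∈ R)
    (α : ℝ) (hα : 1 ≤ α)
    (D : Matrix (Fin n) (Fin n) ℝ)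
    (hD : D = Matrix.diagonal (fun i => if i = j then α else 1))
    (P : Matrix (Fin r) (Fin n) ℝ) (hP : IsMoorePenrose (D * X) P)
    (Q : Matrix (Fin r) (Fin n) ℝ) (hQ : IsMoorePenrose X Q) :
    ∑ i ∈ R, ((D * X) * P) i i ≥ ∑ i ∈ R, (X * Q) i i := by
  subst hD
  set d : Fin n → ℝ := fun i => if i = j then α else 1 with hd
  have hd1 (i : Fin n) : 1 ≤ d i := by
    simp only [hd]
    split_ifs <;> simp [hα]
  have hL : Xᵀ * diagonal (fun i => (d i)⁻¹) * (diagonal d * X) = 1 := by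
    have hinv : diagonal (fun i => (d i)⁻¹) * diagonal d = 1 := by
      rw [diagonal_mul_diagonal, ← diagonal_one]
      congr 1
      funext i
      exact inv_mul_cancel₀ (zero_lt_one.trans_le (hd1 i)).ne'
    rw [Matrix.mul_assoc, ← Matrix.mul_assoc (diagonal _) (diagonal d), hinv, Matrix.one_mul, hX]
  have htrace : ∑ i, (diagonal d * X * P) i i = ∑ i, (X * Q) i i := by
    change trace (diagonal d * X * P) = trace (X * Q)
    rw [trace_mul_comm, hP.mul_eq_one_of_left_inverse hL, trace_mul_comm X,
      hQ.mul_eq_one_of_left_inverse hX]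
  have hcompl : ∑ i ∈ Rᶜ, (diagonal d * X * P) i i ≤ ∑ i ∈ Rᶜ, (X * Q) i i := by
    rw [hQ.eq_transpose hX]
    refine Finset.sum_le_sum fun i hi => leverage_diagonal_mul_le hX hd1 hP (if_neg ?_)
    rintro rfl
    exact Finset.mem_compl.mp hi hj
  rw [← Finset.sum_add_sum_compl R, ← Finset.sum_add_sum_compl R fun i => (X * Q) i i] at htrace
  linarith
end

section
/- Let A ∈ ℝ^{m×n} have singular value decomposition A = UΣVᵀ, let S ∈ ℝ^{n×r} be a column sampling matrix, set C = AS, and let R be an index set such that σ_i(A) > 0 for every i ∈ R. Let σ_ω = max_{i∉R} σ_i(A) and σ_μ = min_{i∈R} σ_i(A). Then ‖CC⁺U_R‖_F² ≥ ‖V_RᵀS‖_F² − (σ_ω²/σ_μ²)·(|R| − ‖V_RᵀS‖_F²). -/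
open Matrix BigOperators Finset

namespace Matrix

theorem IsHermitian.transpose_eq {p : Type*} {M : Matrix p p ℝ} (hM : M.IsHermitian) : Mᵀ = M := by
  simpa [conjTranspose_eq_transpose_of_trivial] using hM.eq

section

variable {p q s : Type*} [Fintype p] [Fintype q] [Fintype s]

theorem PosSemidef.transpose_mul_mul_same {M : Matrix p p ℝ} (hM : M.PosSemidef)
    (B : Matrix p q ℝ) : (Bᵀ * M * B).PosSemidef := by
  simpa [conjTranspose_eq_transpose_of_trivial] using hM.conjTranspose_mul_mul_same B

theorem posSemidef_transpose_mul_self (B : Matrix p q ℝ) : (Bᵀ * B).PosSemidef := by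
  simpa [conjTranspose_eq_transpose_of_trivial] using posSemidef_conjTranspose_mul_self B

theorem trace_transpose_mul_self (B : Matrix p q ℝ) :
    (Bᵀ * B).trace = ∑ j, ∑ i, B i j ^ 2 := by
  simp [trace, mul_apply, sq]

open scoped MatrixOrder in
theorem PosSemidef.trace_mul_nonneg [DecidableEq p] {M N : Matrix p p ℝ}
    (hM : M.PosSemidef) (hN : N.PosSemidef) : 0 ≤ (M * N).trace := by
  obtain ⟨B, rfl⟩ := CStarAlgebra.nonneg_iff_eq_star_mul_self.mp hM.nonneg
  rw [Matrix.mul_assoc, trace_mul_comm, star_eq_conjTranspose]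
  exact (hN.mul_mul_conjTranspose_same B).trace_nonneg

/-- Inversion is antitone on positive definite matrices. -/
theorem PosDef.posSemidef_inv_sub_inv [DecidableEq p] {M N : Matrix p p ℝ}
    (hM : M.PosDef) (hN : N.PosDef) (hMN : (N - M).PosSemidef) :
    (M⁻¹ - N⁻¹).PosSemidef := by
  have hM₁ : M * M⁻¹ = 1 := mul_nonsing_inv _ ((isUnit_iff_isUnit_det _).mp hM.isUnit)
  have hM₂ : M⁻¹ * M = 1 := nonsing_inv_mul _ ((isUnit_iff_isUnit_det _).mp hM.isUnit)
  have hN₁ : N * N⁻¹ = 1 := mul_nonsing_inv _ ((isUnit_iff_isUnit_det _).mp hN.isUnit)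
  have hN₂ : N⁻¹ * N = 1 := nonsing_inv_mul _ ((isUnit_iff_isUnit_det _).mp hN.isUnit)
  have h := (hMN.add (hM.inv.posSemidef.transpose_mul_mul_same (N - M))).transpose_mul_mul_same N⁻¹
  rw [hN.inv.isHermitian.transpose_eq, hMN.isHermitian.transpose_eq] at h
  convert h using 1
  calc M⁻¹ - N⁻¹ = (N⁻¹ * N) * M⁻¹ * (N * N⁻¹) - (N⁻¹ * N) * N⁻¹ := by simp [hN₁, hN₂]
    _ = N⁻¹ * (N * M⁻¹ * N - N) * N⁻¹ := by noncomm_ring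
    _ = N⁻¹ * (N - M + (N * M⁻¹ * N - N * (M⁻¹ * M) - M * M⁻¹ * N + M * M⁻¹ * M)) * N⁻¹ := by
      rw [hM₁, hM₂]; noncomm_ring
    _ = _ := by noncomm_ring

/-- For the orthogonal projection `P` onto a space containing the range of `C`, the matrix `P`
dominates `C H⁻¹ Cᵀ` as soon as `H` dominates `Cᵀ C`. -/
theorem trace_inv_mul_le_trace_proj [DecidableEq q] {P : Matrix p p ℝ} {C : Matrix p q ℝ}
    {H : Matrix q q ℝ} (Y : Matrix p s ℝ) (hP : Pᵀ = P) (hPC : P * C = C)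
    (hH : H.PosDef) (hCH : (H - Cᵀ * C).PosSemidef) :
    (H⁻¹ * (Cᵀ * Y * Yᵀ * C)).trace ≤ ((P * Y)ᵀ * (P * Y)).trace := by
  have hH₁ : H * H⁻¹ = 1 := mul_nonsing_inv _ ((isUnit_iff_isUnit_det _).mp hH.isUnit)
  have hCP : Cᵀ * P = Cᵀ := by
    have := congrArg transpose hPC
    rwa [transpose_mul, hP] at this
  set X := H⁻¹ * Cᵀ * Y with hX
  have hXt : Xᵀ = Yᵀ * C * H⁻¹ := by
    simp only [hX, transpose_mul, transpose_transpose, hH.inv.isHermitian.transpose_eq,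
      Matrix.mul_assoc]
  have hHX : H * X = Cᵀ * Y := by
    rw [hX, Matrix.mul_assoc H⁻¹, ← Matrix.mul_assoc H, hH₁, Matrix.one_mul]
  have h₁ := (posSemidef_transpose_mul_self (P * Y - C * X)).trace_nonneg
  have h₂ := (hCH.transpose_mul_mul_same X).trace_nonneg
  have e₁ : (P * Y - C * X)ᵀ * (P * Y - C * X)
      = (P * Y)ᵀ * (P * Y) - Yᵀ * C * X - Xᵀ * (Cᵀ * Y) + Xᵀ * Cᵀ * C * X := by
    have a₁ : (P * Y)ᵀ * (C * X) = Yᵀ * C * X := by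
      rw [transpose_mul, hP, Matrix.mul_assoc, ← Matrix.mul_assoc P, hPC, Matrix.mul_assoc]
    have a₂ : (C * X)ᵀ * (P * Y) = Xᵀ * (Cᵀ * Y) := by
      rw [transpose_mul, Matrix.mul_assoc, ← Matrix.mul_assoc Cᵀ, hCP]
    rw [transpose_sub, Matrix.sub_mul, Matrix.mul_sub, Matrix.mul_sub, a₁, a₂, transpose_mul C X]
    simp only [Matrix.mul_assoc]
    abel
  have e₂ : Xᵀ * (H - Cᵀ * C) * X = Xᵀ * (Cᵀ * Y) - Xᵀ * Cᵀ * C * X := by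
    rw [Matrix.mul_sub, Matrix.sub_mul, Matrix.mul_assoc Xᵀ H, hHX]
    simp only [Matrix.mul_assoc]
  have e₃ : (Yᵀ * C * X).trace = (H⁻¹ * (Cᵀ * Y * Yᵀ * C)).trace := by
    rw [trace_mul_comm, hX]
    simp only [Matrix.mul_assoc]
  rw [e₁] at h₁
  rw [e₂] at h₂
  simp only [trace_sub, trace_add] at h₁ h₂
  linarith

theorem le_trace_inv_mul [DecidableEq p] {G K : Matrix p p ℝ} {a w e : ℝ} (ha : 0 < a)
    (hw : 0 ≤ w) (he : 0 < e) (hK : K.PosSemidef) (hK₁ : (1 - K).PosSemidef)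
    (hG : (G - a • K).PosSemidef) :
    (G + w • (1 - K) + e • (1 : Matrix p p ℝ)).PosDef ∧
    K.trace + (1 - w / a) * (K * (1 - K)).trace - e / a * K.trace ≤
      ((G + w • (1 - K) + e • (1 : Matrix p p ℝ))⁻¹ * G).trace := by
  set F := w • (1 - K) + e • (1 : Matrix p p ℝ) with hF
  have hFpos : F.PosDef := (PosDef.one.smul he).posSemidef_add (hK₁.smul hw)
  set L := a • K + F with hL
  have hLpos : L.PosDef := hFpos.posSemidef_add (hK.smul ha.le)
  have hHL : G + w • (1 - K) + e • (1 : Matrix p p ℝ) = L + (G - a • K) := by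
    rw [hL, hF]; abel
  rw [hHL]
  set H := L + (G - a • K) with hH
  have hHpos : H.PosDef := hLpos.add_posSemidef hG
  refine ⟨hHpos, ?_⟩
  have hH₂ : H⁻¹ * H = 1 := nonsing_inv_mul _ ((isUnit_iff_isUnit_det _).mp hHpos.isUnit)
  have hL₁ : L * L⁻¹ = 1 := mul_nonsing_inv _ ((isUnit_iff_isUnit_det _).mp hLpos.isUnit)
  have hL₂ : L⁻¹ * L = 1 := nonsing_inv_mul _ ((isUnit_iff_isUnit_det _).mp hLpos.isUnit)
  have h₁ : 0 ≤ ((L⁻¹ - H⁻¹) * F).trace :=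
    (hLpos.posSemidef_inv_sub_inv hHpos (by simpa [hH] using hG)).trace_mul_nonneg
      hFpos.posSemidef
  have e₁ : (L⁻¹ - H⁻¹) * F = H⁻¹ * G - a • (L⁻¹ * K) := by
    have hFL : F = L - a • K := by rw [hL]; abel
    have hFH : F = H - G := by rw [hH, hL]; abel
    rw [Matrix.sub_mul]
    nth_rewrite 1 [hFL]
    rw [hFH, Matrix.mul_sub, Matrix.mul_sub, hL₂, hH₂, Matrix.mul_smul]
    abel
  have hD : (a • (1 : Matrix p p ℝ) - L)ᵀ = a • (1 : Matrix p p ℝ) - L := by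
    rw [transpose_sub, hLpos.isHermitian.transpose_eq]; simp
  have h₂ := (hLpos.inv.posSemidef.transpose_mul_mul_same
    (a • (1 : Matrix p p ℝ) - L)).trace_mul_nonneg hK
  have e₂ : (a • (1 : Matrix p p ℝ) - L)ᵀ * L⁻¹ * (a • (1 : Matrix p p ℝ) - L)
      = (a * a) • L⁻¹ - (2 * a) • (1 : Matrix p p ℝ) + L := by
    rw [hD]
    simp only [Matrix.sub_mul, Matrix.mul_sub, Matrix.smul_mul, Matrix.mul_smul, Matrix.one_mul,
      Matrix.mul_one, hL₁, hL₂]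
    module
  have e₃ : (L * K).trace
      = a * K.trace - a * (K * (1 - K)).trace + w * (K * (1 - K)).trace + e * K.trace := by
    rw [trace_mul_comm]
    simp only [hL, hF, Matrix.mul_add, Matrix.mul_smul, Matrix.mul_sub, Matrix.mul_one, trace_add,
      trace_sub, trace_smul, smul_eq_mul]
    ring
  rw [e₁] at h₁
  rw [e₂] at h₂
  simp only [Matrix.add_mul, Matrix.sub_mul, Matrix.smul_mul, Matrix.one_mul, trace_add,
    trace_sub, trace_smul, smul_eq_mul, e₃] at h₁ h₂
  have h₃ : a * (K.trace + (1 - w / a) * (K * (1 - K)).trace - e / a * K.trace)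
      ≤ a * (H⁻¹ * G).trace := by
    have : a * (K.trace + (1 - w / a) * (K * (1 - K)).trace - e / a * K.trace)
        = a * K.trace + a * (K * (1 - K)).trace - w * (K * (1 - K)).trace - e * K.trace := by
      field_simp
      ring
    nlinarith
  exact le_of_mul_le_mul_left h₃ ha

/-- The projection bound in diagonalised coordinates: `j` selects an index set by its
0-1 indicator, `t` lists the squared singular values, and `N` has orthonormal columns. -/
theorem trace_proj_ge [DecidableEq p] [DecidableEq q] [DecidableEq s]
    {P : Matrix p p ℝ} {C : Matrix p q ℝ} {Y : Matrix p p ℝ}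
    {N : Matrix s q ℝ} {j t : s → ℝ} {a w : ℝ} (ha : 0 < a) (hw : 0 ≤ w)
    (hP : Pᵀ = P) (hPC : P * C = C) (hN : Nᵀ * N = 1)
    (hj : ∀ i, j i = 0 ∨ j i = 1)
    (hja : ∀ i, j i = 1 → a ≤ t i) (hjw : ∀ i, j i = 0 → t i ≤ w)
    (hC : Cᵀ * C = Nᵀ * diagonal t * N)
    (hY : Cᵀ * Y * Yᵀ * C = Nᵀ * diagonal (fun i => j i * t i) * N) :
    (Nᵀ * diagonal j * N).trace - w / a * (∑ i, j i - (Nᵀ * diagonal j * N).trace) ≤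
      ((P * Y)ᵀ * (P * Y)).trace := by
  set K := Nᵀ * diagonal j * N with hKdef
  have hj₀ : ∀ i, 0 ≤ j i := fun i => by rcases hj i with h | h <;> simp [h]
  have hj₁ : ∀ i, j i ≤ 1 := fun i => by rcases hj i with h | h <;> simp [h]
  have diag_psd {d : s → ℝ} (hd : ∀ i, 0 ≤ d i) : (Nᵀ * diagonal d * N).PosSemidef :=
    (PosSemidef.diagonal (Pi.le_def.mpr hd)).transpose_mul_mul_same N
  have hK : K.PosSemidef := diag_psd hj₀
  have one_sub : 1 - K = Nᵀ * diagonal (fun i => 1 - j i) * N := by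
    have : diagonal (fun i => 1 - j i) = 1 - diagonal j := by
      rw [← diagonal_one, diagonal_sub]
    rw [this, Matrix.mul_sub, Matrix.sub_mul, Matrix.mul_one, hN]
  have hK₁ : (1 - K).PosSemidef := one_sub ▸ diag_psd fun i => sub_nonneg.mpr (hj₁ i)
  set G := Nᵀ * diagonal (fun i => j i * t i) * N with hGdef
  have hG : (G - a • K).PosSemidef := by
    have : G - a • K = Nᵀ * diagonal (fun i => j i * t i - a * j i) * N := by
      have : diagonal (fun i => j i * t i - a * j i)
          = diagonal (fun i => j i * t i) - a • diagonal j := by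
        rw [← diagonal_smul, diagonal_sub]; rfl
      rw [this, Matrix.mul_sub, Matrix.sub_mul, Matrix.mul_smul, Matrix.smul_mul]
    rw [this]
    refine diag_psd fun i => ?_
    rcases hj i with h | h
    · simp [h]
    · simpa [h] using hja i h
  have hCG : (G + w • (1 - K) - Cᵀ * C).PosSemidef := by
    have : G + w • (1 - K) - Cᵀ * C
        = Nᵀ * diagonal (fun i => j i * t i + w * (1 - j i) - t i) * N := by
      have : diagonal (fun i => j i * t i + w * (1 - j i) - t i)
          = diagonal (fun i => j i * t i) + w • diagonal (fun i => 1 - j i) - diagonal t := by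
        rw [← diagonal_smul, diagonal_add, diagonal_sub]; rfl
      rw [this, Matrix.mul_sub, Matrix.sub_mul, Matrix.mul_add, Matrix.add_mul, Matrix.mul_smul,
        Matrix.smul_mul, one_sub, hC]
    rw [this]
    refine diag_psd fun i => ?_
    rcases hj i with h | h
    · simpa [h] using hjw i h
    · simp [h]
  have hjj : diagonal j * diagonal j = diagonal j := by
    rw [diagonal_mul_diagonal]
    congr 1
    funext i
    rcases hj i with h | h <;> simp [h]
  have hKK : 0 ≤ (K * (1 - K)).trace := hK.trace_mul_nonneg hK₁
  have hsum : (K * (1 - K)).trace ≤ ∑ i, j i - K.trace := by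
    set B := diagonal j - diagonal j * (N * Nᵀ) * diagonal j with hB
    have h := (posSemidef_transpose_mul_self B).trace_nonneg
    have hBt : Bᵀ = B := by
      simp [hB, transpose_mul, Matrix.mul_assoc]
    have hBB : B * B = diagonal j - diagonal j * (N * Nᵀ) * diagonal j
        - diagonal j * (N * Nᵀ) * diagonal j
        + diagonal j * (N * Nᵀ) * diagonal j * (N * Nᵀ) * diagonal j := by
      have : B * B = diagonal j * diagonal j
          - (diagonal j * diagonal j) * (N * Nᵀ) * diagonal j
          - diagonal j * (N * Nᵀ) * (diagonal j * diagonal j)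
          + diagonal j * (N * Nᵀ) * (diagonal j * diagonal j) * (N * Nᵀ) * diagonal j := by
        rw [hB]; noncomm_ring
      rw [this, hjj]
    have t₁ : (diagonal j * (N * Nᵀ) * diagonal j).trace = K.trace := by
      rw [trace_mul_comm, ← Matrix.mul_assoc, hjj, ← Matrix.mul_assoc, trace_mul_comm,
        ← Matrix.mul_assoc]
    have t₂ : (diagonal j * (N * Nᵀ) * diagonal j * (N * Nᵀ) * diagonal j).trace
        = (K * K).trace := by
      rw [trace_mul_comm]
      have : diagonal j * (diagonal j * (N * Nᵀ) * diagonal j * (N * Nᵀ))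
          = (diagonal j * diagonal j) * N * (Nᵀ * diagonal j * N * Nᵀ) := by
        simp only [Matrix.mul_assoc]
      rw [this, hjj, Matrix.mul_assoc, trace_mul_comm, hKdef]
      rw [Matrix.mul_assoc, trace_mul_comm]
      simp only [Matrix.mul_assoc]
    rw [hBt, hBB] at h
    simp only [trace_add, trace_sub, t₁, t₂, trace_diagonal] at h
    rw [Matrix.mul_sub, Matrix.mul_one, trace_sub]
    linarith
  have key : ∀ e : ℝ, 0 < e →
      K.trace + (1 - w / a) * (K * (1 - K)).trace - e / a * K.trace ≤
        ((P * Y)ᵀ * (P * Y)).trace := by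
    intro e he
    obtain ⟨hH, hle⟩ := le_trace_inv_mul ha hw he hK hK₁ hG
    refine hle.trans ?_
    rw [← hY] at hH ⊢
    refine trace_inv_mul_le_trace_proj Y hP hPC hH ?_
    rw [hY, add_sub_right_comm]
    exact hCG.add (PosSemidef.one.smul he.le)
  have hwa : 0 ≤ w / a := by positivity
  refine le_of_forall_pos_le_add fun δ hδ => ?_
  have hKt := hK.trace_nonneg
  have hk := key (δ * a / (K.trace + 1)) (by positivity)
  have : δ * a / (K.trace + 1) / a * K.trace ≤ δ := by
    have : δ * a / (K.trace + 1) / a * K.trace = δ * (K.trace / (K.trace + 1)) := by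
      field_simp
    rw [this]
    exact mul_le_of_le_one_right hδ.le ((div_le_one (by positivity)).mpr (by linarith))
  have := mul_le_mul_of_nonneg_left hsum hwa
  linarith

end

end Matrix

/-- Lemma on generalized leverage scores and principal angles: with an SVD
`A = U Σ Vᵀ` (singular values `σ` non-increasing and nonnegative), a column sampling matrix
`S`, `C = A S`, an index set `R` of singular-value indices with `σ_i(A) > 0` on `R`,
`σ_ω = max_{i∉R} σ_i(A)` and `σ_μ = min_{i∈R} σ_i(A)` (formalized as `sSup`/`sInf` of the
corresponding sets of singular values), it holds that
`‖C C⁺ U_R‖_F² ≥ ‖V_Rᵀ S‖_F² − (σ_ω²/σ_μ²) (|R| − ‖V_Rᵀ S‖_F²)`.  Here `‖C C⁺ U_R‖_F²` is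
the sum over `i ∈ R` of the squared norms of the corresponding columns of `C C⁺ U`, and
`‖V_Rᵀ S‖_F²` the sum over `i ∈ R` of the squared norms of the corresponding rows of
`Vᵀ S`. -/
theorem stmt11 {m n r : ℕ}
    (A : Matrix (Fin m) (Fin n) ℝ)
    (U : Matrix (Fin m) (Fin m) ℝ) (V : Matrix (Fin n) (Fin n) ℝ)
    (σ : ℕ → ℝ)
    (hU : Uᵀ * U = 1) (hV : Vᵀ * V = 1)
    (hσ_nonneg : ∀ i, 0 ≤ σ i)
    (hσ_mono : ∀ i j : ℕ, i ≤ j → σ j ≤ σ i)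
    (hA : A = U * (Matrix.of fun (i : Fin m) (j : Fin n) =>
        if (i : ℕ) = (j : ℕ) then σ i else 0) * Vᵀ)
    (f : Fin r → Fin n) (hf : Function.Injective f)
    (S : Matrix (Fin n) (Fin r) ℝ)
    (hS : S = Matrix.of fun i j => if i = f j then (1 : ℝ) else 0)
    (C : Matrix (Fin m) (Fin r) ℝ) (hC : C = A * S)
    (Cp : Matrix (Fin r) (Fin m) ℝ) (hCp : IsMoorePenrose C Cp)
    (R : Finset ℕ) (hR : ∀ i ∈ R, i < min m n)
    (hRpos : ∀ i ∈ R, 0 < σ i)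
    (σω σμ : ℝ)
    (hσω : σω = sSup (σ '' {i : ℕ | i < min m n ∧ i ∉ R}))
    (hσμ : σμ = sInf (σ '' {i : ℕ | i ∈ R})) :
    ∑ i ∈ Finset.univ.filter (fun i : Fin m => (i : ℕ) ∈ R),
        ∑ l, ((C * Cp * U) l i) ^ 2
      ≥ (∑ i ∈ Finset.univ.filter (fun i : Fin n => (i : ℕ) ∈ R),
            ∑ j, ((Vᵀ * S) i j) ^ 2)
        - (σω ^ 2 / σμ ^ 2) *
            ((R.card : ℝ) -
              ∑ i ∈ Finset.univ.filter (fun i : Fin n => (i : ℕ) ∈ R),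
                ∑ j, ((Vᵀ * S) i j) ^ 2) := by
  obtain ⟨hCC, -, hsym, -⟩ := hCp
  rcases R.eq_empty_or_nonempty with rfl | hne
  · simp
  have hfin : (σ '' {i : ℕ | i ∈ R}).Finite := (R.finite_toSet).image σ
  have hnon : (σ '' {i : ℕ | i ∈ R}).Nonempty := Set.Nonempty.image σ hne
  have hμpos : 0 < σμ := by
    obtain ⟨i, hi, h⟩ := hnon.csInf_mem hfin
    rw [hσμ, ← h]
    exact hRpos i hi
  have hμle : ∀ i ∈ R, σμ ≤ σ i := fun i hi =>
    hσμ ▸ csInf_le hfin.bddBelow ⟨i, hi, rfl⟩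
  have hωle : ∀ i, i < min m n → i ∉ R → σ i ≤ σω := fun i hi hiR =>
    hσω ▸ le_csSup ⟨σ 0, by rintro _ ⟨k, -, rfl⟩; exact hσ_mono 0 k k.zero_le⟩ ⟨i, ⟨hi, hiR⟩, rfl⟩
  set D : Matrix (Fin m) (Fin n) ℝ :=
    Matrix.of fun (i : Fin m) (j : Fin n) => if (i : ℕ) = (j : ℕ) then σ i else 0 with hD
  set N := Vᵀ * S with hNdef
  have hVV : V * Vᵀ = 1 := mul_eq_one_comm.mp hV
  have hSS : Sᵀ * S = 1 := by
    ext i j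
    simp [hS, mul_apply, one_apply, hf.eq_iff, eq_comm]
  have hN : Nᵀ * N = 1 := by
    rw [hNdef, transpose_mul, transpose_transpose, Matrix.mul_assoc, ← Matrix.mul_assoc V, hVV,
      Matrix.one_mul, hSS]
  have hCN : C = U * D * N := by
    rw [hC, hA, hNdef]; simp only [Matrix.mul_assoc]
  have hUC : Uᵀ * C = D * N := by
    rw [hCN, Matrix.mul_assoc, ← Matrix.mul_assoc Uᵀ, hU, Matrix.one_mul]
  clear_value N
  let ind (k : ℕ) : ℝ := if k ∈ R then 1 else 0
  let t (k : Fin n) : ℝ := if (k : ℕ) < m then σ k ^ 2 else 0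
  have hsandwich (d : ℕ → ℝ) : Dᵀ * diagonal (fun i : Fin m => d i) * D
      = diagonal (fun k : Fin n => d k * t k) := by
    ext k l
    rw [mul_apply]
    simp only [mul_diagonal, transpose_apply, hD, of_apply, diagonal_apply, t]
    by_cases hk : (k : ℕ) < m
    · rw [Finset.sum_eq_single (⟨k, hk⟩ : Fin m)]
      · by_cases hkl : k = l
        · subst hkl; simp [hk]; ring
        · simp [hkl, Fin.val_inj]
      · intro b _ hb
        have : (b : ℕ) ≠ k := fun h => hb (Fin.ext h)
        simp [this]
      · simp
    · have : ∀ b : Fin m, (b : ℕ) ≠ k := fun b h => hk (h ▸ b.2)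
      simp [this, hk]
  have hCtC : Cᵀ * C = Nᵀ * diagonal t * N := by
    have h := hsandwich fun _ => 1
    simp only [diagonal_one, Matrix.mul_one, one_mul] at h
    rw [show diagonal t = Dᵀ * D from h.symm, hCN, transpose_mul, transpose_mul]
    calc Nᵀ * (Dᵀ * Uᵀ) * (U * D * N) = Nᵀ * Dᵀ * (Uᵀ * U) * D * N := by
          simp only [Matrix.mul_assoc]
      _ = _ := by rw [hU, Matrix.mul_one]; simp only [Matrix.mul_assoc]
  set J : Matrix (Fin m) (Fin m) ℝ := diagonal (fun i => ind i) with hJ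
  have hJJ : J * Jᵀ = J := by
    rw [hJ, diagonal_transpose, diagonal_mul_diagonal]
    congr 1
    funext i
    simp only [ind]
    split_ifs <;> simp
  have hY : Cᵀ * (U * J) * (U * J)ᵀ * C
      = Nᵀ * diagonal (fun k : Fin n => ind k * t k) * N := by
    have hCU : Cᵀ * U = Nᵀ * Dᵀ := by
      simpa [transpose_mul] using congrArg transpose hUC
    rw [← hsandwich ind, ← hJ]
    calc Cᵀ * (U * J) * (U * J)ᵀ * C = (Cᵀ * U) * (J * Jᵀ) * (Uᵀ * C) := by
          simp only [transpose_mul, Matrix.mul_assoc]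
      _ = _ := by rw [hCU, hUC, hJJ]; simp only [Matrix.mul_assoc]
  have main := trace_proj_ge (P := C * Cp) (C := C) (Y := U * J) (N := N)
    (j := fun k : Fin n => ind k) (t := t) (a := σμ ^ 2) (w := σω ^ 2)
    (by positivity) (by positivity) hsym
    hCC hN
    (fun i => by simp only [ind]; split_ifs <;> simp)
    (fun i hi => by
      have hiR : (i : ℕ) ∈ R := by by_contra h; simp [ind, h] at hi
      have him : (i : ℕ) < m := (hR i hiR).trans_le (min_le_left _ _)
      simpa [t, him] using pow_le_pow_left₀ hμpos.le (hμle i hiR) 2)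
    (fun i hi => by
      have hiR : (i : ℕ) ∉ R := fun h => by simp [ind, h] at hi
      by_cases him : (i : ℕ) < m
      · simpa [t, him] using
          pow_le_pow_left₀ (hσ_nonneg i) (hωle i (lt_min him i.2) hiR) 2
      · simpa [t, him] using sq_nonneg σω)
    hCtC hY
  have hleft : ((C * Cp * (U * J))ᵀ * (C * Cp * (U * J))).trace
      = ∑ i ∈ Finset.univ.filter (fun i : Fin m => (i : ℕ) ∈ R),
        ∑ l, ((C * Cp * U) l i) ^ 2 := by
    rw [trace_transpose_mul_self, Finset.sum_filter]
    refine Finset.sum_congr rfl fun i _ => ?_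
    rw [← Matrix.mul_assoc (C * Cp)]
    simp only [hJ, mul_diagonal, ind]
    split_ifs <;> simp
  have hright : (Nᵀ * diagonal (fun k : Fin n => ind k) * N).trace
      = ∑ i ∈ Finset.univ.filter (fun i : Fin n => (i : ℕ) ∈ R), ∑ j, (N i j) ^ 2 := by
    rw [Matrix.mul_assoc, trace_mul_comm, Finset.sum_filter, trace]
    refine Finset.sum_congr rfl fun i _ => ?_
    rw [diag_apply, Matrix.mul_assoc, diagonal_mul, mul_apply]
    simp only [ind, transpose_apply, ← sq]
    split_ifs <;> simp
  have hcard : ∑ k : Fin n, ind k = (R.card : ℝ) := by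
    rw [Fin.sum_univ_eq_sum_range ind n]
    have : (Finset.range n).filter (· ∈ R) = R := by
      ext k
      simpa using fun hk => (hR k hk).trans_le (min_le_right _ _)
    simp only [ind]
    rw [← Finset.sum_filter, this]
    simp
  rw [hleft, hright, hcard] at main
  exact main
end

section
/- Let A ∈ ℝ^{m×n} have singular value decomposition A = UΣVᵀ, let R be an index set with σ_i(A) > 0 for every i ∈ R, let σ_ω = max_{i∉R} σ_i(A) > 0 and σ_μ = min_{i∈R} σ_i(A), and let ε ≥ 0. If S ∈ ℝ^{n×r} is a column sampling matrix satisfying ‖V_RᵀS‖_F² ≥ |R| − ε·σ_μ²/(2σ_ω²), and C = AS, then ‖CC⁺U_R‖_F² ≥ ‖V_RᵀS‖_F² − ε. -/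
open Matrix BigOperators Finset

theorem sum_sq_eq_trace {a b : Type*} [Fintype a] [Fintype b] (M : Matrix a b ℝ) :
    ∑ i, ∑ j, M i j ^ 2 = (M * Mᵀ).trace := by
  simp [Matrix.trace, Matrix.mul_apply, sq]

/-- Bessel's inequality for the rows of `M` and the orthonormal columns of `Q`. -/
theorem sum_sq_mul_le_of_orthonormal {a b c : Type*} [Fintype a] [Fintype b] [Fintype c]
    [DecidableEq c] (M : Matrix a b ℝ) (Q : Matrix b c ℝ) (hQ : Qᵀ * Q = 1) :
    ∑ i, ∑ j, (M * Q) i j ^ 2 ≤ ∑ i, ∑ j, M i j ^ 2 := by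
  have h0 : 0 ≤ ∑ i, ∑ j, (M - M * Q * Qᵀ) i j ^ 2 := by positivity
  have h1 : (M - M * Q * Qᵀ) * (M - M * Q * Qᵀ)ᵀ = M * Mᵀ - (M * Q) * (M * Q)ᵀ := by
    have h2 : M * Q * Qᵀ * (Q * Qᵀ * Mᵀ) = M * Q * Qᵀ * Mᵀ := by
      rw [show M * Q * Qᵀ * (Q * Qᵀ * Mᵀ) = M * Q * (Qᵀ * Q) * Qᵀ * Mᵀ by
        simp only [Matrix.mul_assoc], hQ, Matrix.mul_one]
    simp only [Matrix.transpose_sub, Matrix.transpose_mul, Matrix.transpose_transpose,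
      Matrix.sub_mul, Matrix.mul_sub]
    rw [← Matrix.mul_assoc Q, h2]
    simp only [Matrix.mul_assoc]
    abel
  rw [sum_sq_eq_trace, h1, Matrix.trace_sub] at h0
  rw [sum_sq_eq_trace, sum_sq_eq_trace]
  linarith

/-- The columns of an orthonormal system number at most the dimension. -/
theorem card_le_of_orthonormal {b c : Type*} [Fintype b] [Fintype c] [DecidableEq b]
    [DecidableEq c] (Q : Matrix b c ℝ) (hQ : Qᵀ * Q = 1) :
    (Fintype.card c : ℝ) ≤ Fintype.card b := by
  have h := sum_sq_mul_le_of_orthonormal (1 : Matrix b b ℝ) Q hQ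
  rw [Matrix.one_mul, sum_sq_eq_trace, sum_sq_eq_trace, Matrix.trace_mul_comm, hQ] at h
  simpa using h

theorem dotProduct_sub_proj {a : Type*} [Fintype a] (P : Matrix a a ℝ)
    (hPt : Pᵀ = P) (hPP : P * P = P) (v : a → ℝ) :
    (v - P *ᵥ v) ⬝ᵥ (v - P *ᵥ v) = v ⬝ᵥ v - (P *ᵥ v) ⬝ᵥ (P *ᵥ v) := by
  have h : (P *ᵥ v) ⬝ᵥ (P *ᵥ v) = v ⬝ᵥ (P *ᵥ v) := by
    rw [Matrix.dotProduct_mulVec, ← Matrix.mulVec_transpose, hPt, Matrix.mulVec_mulVec, hPP,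
      dotProduct_comm]
  simp only [sub_dotProduct, dotProduct_sub]
  rw [dotProduct_comm (P *ᵥ v) v, h]
  ring

/-- If `v + e` is fixed by the orthogonal projection `P`, then `v` is at most `‖e‖` away
from its projection. -/
theorem dotProduct_proj_ge {a : Type*} [Fintype a] (P : Matrix a a ℝ)
    (hPt : Pᵀ = P) (hPP : P * P = P) (v e : a → ℝ) (h : P *ᵥ (v + e) = v + e) :
    v ⬝ᵥ v - e ⬝ᵥ e ≤ (P *ᵥ v) ⬝ᵥ (P *ᵥ v) := by
  have h1 := dotProduct_sub_proj P hPt hPP v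
  have h2 := dotProduct_sub_proj P hPt hPP e
  have h3 : v - P *ᵥ v = -(e - P *ᵥ e) := by
    rw [Matrix.mulVec_add] at h
    rw [neg_sub, sub_eq_sub_iff_add_eq_add, ← h]
    abel
  rw [h3, neg_dotProduct_neg, h2] at h1
  have h4 : 0 ≤ (P *ᵥ e) ⬝ᵥ (P *ᵥ e) := dotProduct_self_star_nonneg (P *ᵥ e)
  linarith

theorem exists_orthogonal_diagonalization {b c : Type*} [Fintype b] [Fintype c]
    [DecidableEq c] (B : Matrix b c ℝ) :
    ∃ (O : Matrix c c ℝ) (l : c → ℝ), Oᵀ * O = 1 ∧ O * Oᵀ = 1 ∧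
      (B * O)ᵀ * (B * O) = Matrix.diagonal l := by
  have hH : (Bᵀ * B).IsHermitian := by
    simpa using Matrix.isHermitian_conjTranspose_mul_self B
  let O : Matrix c c ℝ := hH.eigenvectorUnitary
  have hO1 : Oᵀ * O = 1 := Unitary.coe_star_mul_self hH.eigenvectorUnitary
  have hO2 : O * Oᵀ = 1 := Unitary.coe_mul_star_self hH.eigenvectorUnitary
  refine ⟨O, hH.eigenvalues, hO1, hO2, ?_⟩
  have h : Bᵀ * B = O * Matrix.diagonal hH.eigenvalues * Oᵀ := by
    have := hH.spectral_theorem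
    simpa [Unitary.conjStarAlgAut_apply, Function.comp_def, Matrix.star_eq_conjTranspose] using this
  calc (B * O)ᵀ * (B * O) = Oᵀ * (Bᵀ * B) * O := by
        simp only [Matrix.transpose_mul, Matrix.mul_assoc]
    _ = Oᵀ * (O * Matrix.diagonal hH.eigenvalues * Oᵀ) * O := congrArg (Oᵀ * · * O) h
    _ = (Oᵀ * O) * Matrix.diagonal hH.eigenvalues * (Oᵀ * O) := by simp only [Matrix.mul_assoc]
    _ = Matrix.diagonal hH.eigenvalues := by rw [hO1, Matrix.one_mul, Matrix.mul_one]

/-- Scalar estimate for one singular direction: `t` is the squared length `ℓ` of a vector after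
projection, `s` the squared length before scaling by singular values. -/
theorem sub_le_div_of_le {s t l ω μ : ℝ} (hμ : 0 < μ) (hl : 0 < l) (hs0 : 0 ≤ s) (hs1 : s ≤ 1)
    (hω : 0 ≤ ω) (hsl : μ * s ≤ l) (ht0 : 0 ≤ t) (ht : l - ω * (1 - s) ≤ t) :
    s - ω / μ * (1 - s) ≤ t / l := by
  have hsμ : s / l ≤ 1 / μ := by rw [div_le_div_iff₀ hl hμ]; linarith
  have h1 : 1 - ω * (1 - s) / l ≤ t / l := by
    rw [le_div_iff₀ hl, sub_mul, div_mul_cancel₀ _ hl.ne']; linarith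
  have h2 : 0 ≤ t / l := by positivity
  have h3 : s * (1 - ω * (1 - s) / l) ≤ s * (t / l) := mul_le_mul_of_nonneg_left h1 hs0
  have h4 : (1 - s) * 0 ≤ (1 - s) * (t / l) := mul_le_mul_of_nonneg_left h2 (by linarith)
  have h5 : ω * (1 - s) * (s / l) ≤ ω * (1 - s) * (1 / μ) :=
    mul_le_mul_of_nonneg_left hsμ (mul_nonneg hω (by linarith))
  have h6 : s * (1 - ω * (1 - s) / l) = s - ω * (1 - s) * (s / l) := by ring
  have h7 : ω / μ * (1 - s) = ω * (1 - s) * (1 / μ) := by ring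
  linarith

/-- Lower bound for the part of the orthonormal columns `W` captured by a projection `P` fixing
`W * diagonal d * X + D`. -/
theorem sum_sq_proj_ge {a k c : Type*} [Fintype a] [Fintype k] [Fintype c]
    [DecidableEq k] [DecidableEq c]
    (W : Matrix a k ℝ) (hW : Wᵀ * W = 1) (d : k → ℝ) (X : Matrix k c ℝ) (D : Matrix a c ℝ)
    (P : Matrix a a ℝ) (hPt : Pᵀ = P) (hPP : P * P = P)
    (hP : P * (W * Matrix.diagonal d * X + D) = W * Matrix.diagonal d * X + D)
    {μ ω : ℝ} (hμ : 0 < μ) (hd : ∀ i, μ ≤ d i) (hω : 0 < ω)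
    (hD : ∀ y, (D *ᵥ y) ⬝ᵥ (D *ᵥ y) ≤ ω ^ 2 * (y ⬝ᵥ y - (X *ᵥ y) ⬝ᵥ (X *ᵥ y))) :
    ∑ i, ∑ j, X i j ^ 2 - ω ^ 2 / μ ^ 2 * (Fintype.card k - ∑ i, ∑ j, X i j ^ 2)
      ≤ ∑ i, ∑ j, (P * W) i j ^ 2 := by
  classical
  obtain ⟨O, l, hO1, hO2, hl⟩ := exists_orthogonal_diagonalization (Matrix.diagonal d * X)
  let y : c → c → ℝ := fun j => Oᵀ j
  have hy : ∀ j, y j ⬝ᵥ y j = 1 := fun j => by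
    have := congrFun (congrFun hO1 j) j
    simpa [Matrix.mul_apply, dotProduct, y] using this
  let s : c → ℝ := fun j => (X *ᵥ y j) ⬝ᵥ (X *ᵥ y j)
  have hs0 : ∀ j, 0 ≤ s j := fun j => dotProduct_self_star_nonneg (X *ᵥ y j)
  have hs1 : ∀ j, s j ≤ 1 := fun j => by
    have h1 := hD (y j)
    have h2 : 0 ≤ (D *ᵥ y j) ⬝ᵥ (D *ᵥ y j) := dotProduct_self_star_nonneg (D *ᵥ y j)
    have h3 := nonneg_of_mul_nonneg_right (h2.trans h1) (by positivity)
    rw [hy] at h3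
    exact sub_nonneg.mp h3
  have hsum : ∑ j, s j = ∑ i, ∑ j, X i j ^ 2 := by
    have h1 : ∑ i, ∑ j, X i j ^ 2 = ∑ i, ∑ j, (X * O) i j ^ 2 := by
      rw [sum_sq_eq_trace, sum_sq_eq_trace, Matrix.transpose_mul, Matrix.mul_assoc,
        ← Matrix.mul_assoc O, hO2, Matrix.one_mul]
    rw [h1, Finset.sum_comm]
    refine Finset.sum_congr rfl fun j _ => ?_
    simp [s, y, dotProduct, Matrix.mulVec, Matrix.mul_apply, sq]
  let z : c → k → ℝ := fun j => Matrix.diagonal d *ᵥ (X *ᵥ y j)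
  have hzz : ∀ i j, z i ⬝ᵥ z j = Matrix.diagonal l i j := fun i j => by
    have h1 : ∀ j, z j = fun a => (Matrix.diagonal d * X * O) a j := fun j => by
      simp only [z, y, Matrix.mulVec_mulVec]
      rfl
    rw [← hl, h1, h1]
    rfl
  have hzl : ∀ j, z j ⬝ᵥ z j = l j := fun j => by rw [hzz, Matrix.diagonal_apply_eq]
  have hsl : ∀ j, μ ^ 2 * s j ≤ l j := fun j => by
    rw [← hzl]
    simp only [s, z, dotProduct, Matrix.mulVec_diagonal, Finset.mul_sum]
    refine Finset.sum_le_sum fun i _ => ?_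
    have h1 : μ ^ 2 ≤ d i ^ 2 := pow_le_pow_left₀ hμ.le (hd i) 2
    nlinarith [mul_le_mul_of_nonneg_right h1 (mul_self_nonneg ((X *ᵥ y j) i))]
  have hWz : ∀ j, (W *ᵥ z j) ⬝ᵥ (W *ᵥ z j) = l j := fun j => by
    rw [Matrix.dotProduct_mulVec, ← Matrix.mulVec_transpose, Matrix.mulVec_mulVec, hW,
      Matrix.one_mulVec, hzl]
  let t : c → ℝ := fun j => (P *ᵥ (W *ᵥ z j)) ⬝ᵥ (P *ᵥ (W *ᵥ z j))
  have ht : ∀ j, l j - ω ^ 2 * (1 - s j) ≤ t j := fun j => by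
    have h1 : W *ᵥ z j + D *ᵥ y j = (W * Matrix.diagonal d * X + D) *ᵥ y j := by
      simp only [z, Matrix.add_mulVec, Matrix.mulVec_mulVec, Matrix.mul_assoc]
    have h2 := dotProduct_proj_ge P hPt hPP (W *ᵥ z j) (D *ᵥ y j) (by
      rw [h1, Matrix.mulVec_mulVec, hP])
    have h3 := hD (y j)
    rw [hy] at h3
    rw [hWz] at h2
    exact le_trans (by linarith) h2
  let τ := {j : c // 0 < l j}
  let Q : Matrix k τ ℝ := Matrix.of fun i j => z j i / √(l j)
  have hQ : Qᵀ * Q = 1 := by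
    ext i j
    have h1 : (Qᵀ * Q) i j = (z i ⬝ᵥ z j) / (√(l i) * √(l j)) := by
      simp only [Q, Matrix.mul_apply, dotProduct, Finset.sum_div, Matrix.transpose_apply,
        Matrix.of_apply]
      exact Finset.sum_congr rfl fun _ _ => by ring
    rw [h1, hzz]
    by_cases hij : i = j
    · subst hij
      rw [Matrix.diagonal_apply_eq, Real.mul_self_sqrt i.2.le, Matrix.one_apply_eq,
        div_self i.2.ne']
    · rw [Matrix.diagonal_apply_ne _ (fun h => hij (Subtype.ext h)), Matrix.one_apply_ne hij,
        zero_div]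
  have hPQ : ∑ i, ∑ j, (P * W * Q) i j ^ 2 = ∑ j : τ, t j / l j := by
    rw [Finset.sum_comm]
    refine Finset.sum_congr rfl fun j _ => ?_
    have h1 : ∀ i, (P * W * Q) i j = (P *ᵥ (W *ᵥ z j)) i / √(l j) := fun i => by
      rw [Matrix.mulVec_mulVec]
      simp only [Q, Matrix.mul_apply (N := Q), Matrix.mulVec, dotProduct, Finset.sum_div,
        Matrix.of_apply, mul_div_assoc]
    simp only [h1, div_pow, Real.sq_sqrt j.2.le, t, dotProduct, ← sq, Finset.sum_div]
  have hbessel := sum_sq_mul_le_of_orthonormal (P * W) Q hQ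
  have hcard := card_le_of_orthonormal Q hQ
  have hterm : ∀ j : τ, s j - ω ^ 2 / μ ^ 2 * (1 - s j) ≤ t j / l j := fun j =>
    sub_le_div_of_le (by positivity) j.2 (hs0 j) (hs1 j) (by positivity) (hsl j)
      (dotProduct_self_star_nonneg (P *ᵥ (W *ᵥ z j))) (ht j)
  have hsumτ : ∑ j : τ, s j = ∑ j, s j := by
    rw [← Finset.sum_subtype {j | 0 < l j} (by simp) s]
    refine Finset.sum_subset (Finset.subset_univ _) fun j _ hj => ?_
    have h1 : l j ≤ 0 := by simpa using hj
    exact le_antisymm (nonpos_of_mul_nonpos_right ((hsl j).trans h1) (by positivity)) (hs0 j)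
  have hfin := Finset.sum_le_sum fun (j : τ) (_ : j ∈ Finset.univ) => hterm j
  rw [Finset.sum_sub_distrib, ← Finset.mul_sum, Finset.sum_sub_distrib, hsumτ, hsum] at hfin
  rw [hPQ] at hbessel
  have hmul := mul_le_mul_of_nonneg_left hcard (show 0 ≤ ω ^ 2 / μ ^ 2 by positivity)
  simp only [Finset.sum_const, Finset.card_univ, nsmul_eq_mul, mul_one] at hfin
  linarith

theorem sum_filter_mem_eq {N : ℕ} (R : Finset ℕ) (hR : ∀ i ∈ R, i < N) (F : Fin N → ℝ) :
    ∑ i ∈ Finset.univ.filter (fun i : Fin N => (i : ℕ) ∈ R), F i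
      = ∑ i : R, F ⟨i, hR i i.2⟩ := by
  refine (Finset.sum_bij (fun (i : R) _ => (⟨i, hR i i.2⟩ : Fin N)) ?_ ?_ ?_ ?_).symm
  · simp
  · intro i _ j _ h
    exact Subtype.ext (Fin.mk.inj_iff.mp h)
  · intro j hj
    exact ⟨⟨j, by simpa using hj⟩, Finset.mem_univ _, rfl⟩
  · intros
    rfl

theorem dotProduct_orthogonal_mulVec {a b : Type*} [Fintype a] [Fintype b] [DecidableEq b]
    {U : Matrix a b ℝ} (hU : Uᵀ * U = 1) (v : b → ℝ) :
    (U *ᵥ v) ⬝ᵥ (U *ᵥ v) = v ⬝ᵥ v := by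
  rw [Matrix.dotProduct_mulVec, ← Matrix.mulVec_transpose, Matrix.mulVec_mulVec, hU,
    Matrix.one_mulVec]

/-- The part of a rectangular diagonal matrix indexed outside `R`. -/
def rectDiagOutside (m n : ℕ) (σ : ℕ → ℝ) (R : Finset ℕ) : Matrix (Fin m) (Fin n) ℝ :=
  Matrix.of fun i j => if (i : ℕ) = j ∧ (j : ℕ) ∉ R then σ i else 0

theorem rectDiag_eq {m n : ℕ} (σ : ℕ → ℝ) (R : Finset ℕ) (hm : ∀ i ∈ R, i < m)
    (hn : ∀ i ∈ R, i < n) (U : Matrix (Fin m) (Fin m) ℝ) {c : Type*} (Z : Matrix (Fin n) c ℝ) :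
    U * (Matrix.of fun (i : Fin m) (j : Fin n) => if (i : ℕ) = (j : ℕ) then σ i else 0) * Z
      = U.submatrix id (fun i : R => ⟨i, hm i i.2⟩) * Matrix.diagonal (fun i : R => σ i)
          * Z.submatrix (fun i : R => ⟨i, hn i i.2⟩) id
        + U * rectDiagOutside m n σ R * Z := by
  have h : (Matrix.of fun (i : Fin m) (j : Fin n) => if (i : ℕ) = (j : ℕ) then σ i else 0)
      = (1 : Matrix (Fin m) (Fin m) ℝ).submatrix id (fun i : R => ⟨i, hm i i.2⟩)
          * Matrix.diagonal (fun i : R => σ i)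
          * (1 : Matrix (Fin n) (Fin n) ℝ).submatrix (fun i : R => ⟨i, hn i i.2⟩) id
        + rectDiagOutside m n σ R := by
    ext i j
    simp only [rectDiagOutside, Matrix.add_apply, Matrix.of_apply]
    rw [Matrix.mul_apply]
    simp only [Matrix.mul_diagonal, Matrix.submatrix_apply, id, Matrix.one_apply, Fin.ext_iff,
      ite_mul, one_mul, zero_mul, mul_ite, mul_one, mul_zero]
    by_cases hj : (j : ℕ) ∈ R
    · rw [Finset.sum_eq_single (⟨j, hj⟩ : R)]
      · by_cases hij : (i : ℕ) = j <;> simp [hij, hj]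
      · intro x _ hx
        exact if_neg fun h => hx (Subtype.ext h)
      · simp
    · rw [Finset.sum_eq_zero]
      · simp [hj]
      · intro x _
        exact if_neg fun h : (x : ℕ) = j => hj (h ▸ x.2)
  have hU : U * (1 : Matrix (Fin m) (Fin m) ℝ).submatrix id (fun i : R => ⟨i, hm i i.2⟩)
      = U.submatrix id (fun i : R => ⟨i, hm i i.2⟩) := by
    ext; simp [Matrix.mul_apply, Matrix.one_apply]
  have hZ : (1 : Matrix (Fin n) (Fin n) ℝ).submatrix (fun i : R => ⟨i, hn i i.2⟩) id * Z
      = Z.submatrix (fun i : R => ⟨i, hn i i.2⟩) id := by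
    ext; simp [Matrix.mul_apply, Matrix.one_apply]
  rw [h, Matrix.mul_add, Matrix.add_mul, ← hU, ← hZ]
  simp only [Matrix.mul_assoc]

theorem rectDiagOutside_mulVec_le {m n : ℕ} (σ : ℕ → ℝ) (hσ : ∀ i, 0 ≤ σ i) (R : Finset ℕ)
    (hn : ∀ i ∈ R, i < n) {ω : ℝ} (hω : ∀ i, i < m → i < n → i ∉ R → σ i ≤ ω) (w : Fin n → ℝ) :
    (rectDiagOutside m n σ R *ᵥ w) ⬝ᵥ (rectDiagOutside m n σ R *ᵥ w)
      ≤ ω ^ 2 * (w ⬝ᵥ w - ∑ i : R, w ⟨i, hn i i.2⟩ ^ 2) := by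
  have hsq : (rectDiagOutside m n σ R)ᵀ * rectDiagOutside m n σ R
      = Matrix.diagonal fun j : Fin n => if (j : ℕ) < m ∧ (j : ℕ) ∉ R then σ j ^ 2 else 0 := by
    ext i j
    simp only [rectDiagOutside, Matrix.mul_apply, Matrix.transpose_apply, Matrix.of_apply,
      Matrix.diagonal_apply]
    by_cases him : (i : ℕ) < m
    · rw [Finset.sum_eq_single (⟨i, him⟩ : Fin m)]
      · by_cases hij : i = j
        · subst hij
          by_cases hi : (i : ℕ) ∈ R <;> simp [hi, him, sq]
        · simp [hij, Fin.val_ne_of_ne hij]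
      · intro x _ hx
        rw [if_neg (fun h => hx (Fin.ext h.1)), zero_mul]
      · simp
    · rw [Finset.sum_eq_zero]
      · simp [him]
      · intro x _
        rw [if_neg (fun h : (x : ℕ) = i ∧ _ => him (h.1 ▸ x.2)), zero_mul]
  rw [Matrix.dotProduct_mulVec, ← Matrix.mulVec_transpose, Matrix.mulVec_mulVec, hsq,
    ← sum_filter_mem_eq R hn fun i => w i ^ 2, Finset.sum_filter, dotProduct, dotProduct,
    ← Finset.sum_sub_distrib, Finset.mul_sum]
  refine Finset.sum_le_sum fun j _ => ?_
  rw [Matrix.mulVec_diagonal]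
  by_cases hj : (j : ℕ) ∈ R
  · simp [hj, sq]
  · by_cases hjm : (j : ℕ) < m
    · have h1 : σ j ^ 2 ≤ ω ^ 2 := pow_le_pow_left₀ (hσ j) (hω j hjm j.2 hj) 2
      simpa [hj, hjm, mul_assoc] using mul_le_mul_of_nonneg_right h1 (mul_self_nonneg (w j))
    · simpa [hj, hjm] using mul_nonneg (sq_nonneg ω) (mul_self_nonneg (w j))

/-- Theorem on generalized leverage scores: with an SVD `A = U Σ Vᵀ`, an
index set `R` with `σ_i(A) > 0` on `R`, `σ_ω = max_{i∉R} σ_i(A) > 0`,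
`σ_μ = min_{i∈R} σ_i(A)`, and `ε ≥ 0`: if the column sampling matrix `S` satisfies
`‖V_Rᵀ S‖_F² ≥ |R| − ε σ_μ²/(2 σ_ω²)` and `C = A S`, then
`‖C C⁺ U_R‖_F² ≥ ‖V_Rᵀ S‖_F² − ε`. -/
theorem stmt13 {m n r : ℕ}
    (A : Matrix (Fin m) (Fin n) ℝ)
    (U : Matrix (Fin m) (Fin m) ℝ) (V : Matrix (Fin n) (Fin n) ℝ)
    (σ : ℕ → ℝ)
    (hU : Uᵀ * U = 1) (hV : Vᵀ * V = 1)
    (hσ_nonneg : ∀ i, 0 ≤ σ i)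
    (hσ_mono : ∀ i j : ℕ, i ≤ j → σ j ≤ σ i)
    (hA : A = U * (Matrix.of fun (i : Fin m) (j : Fin n) =>
        if (i : ℕ) = (j : ℕ) then σ i else 0) * Vᵀ)
    (R : Finset ℕ) (hR : ∀ i ∈ R, i < min m n)
    (hRpos : ∀ i ∈ R, 0 < σ i)
    (σω σμ : ℝ)
    (hσω : σω = sSup (σ '' {i : ℕ | i < min m n ∧ i ∉ R})) (hσω_pos : 0 < σω)
    (hσμ : σμ = sInf (σ '' {i : ℕ | i ∈ R}))
    (ε : ℝ) (hε : 0 ≤ ε)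
    (f : Fin r → Fin n) (hf : Function.Injective f)
    (S : Matrix (Fin n) (Fin r) ℝ)
    (hS : S = Matrix.of fun i j => if i = f j then (1 : ℝ) else 0)
    (hVS : ∑ i ∈ Finset.univ.filter (fun i : Fin n => (i : ℕ) ∈ R),
        ∑ j, ((Vᵀ * S) i j) ^ 2 ≥ (R.card : ℝ) - ε * σμ ^ 2 / (2 * σω ^ 2))
    (C : Matrix (Fin m) (Fin r) ℝ) (hC : C = A * S)
    (Cp : Matrix (Fin r) (Fin m) ℝ) (hCp : IsMoorePenrose C Cp) :
    ∑ i ∈ Finset.univ.filter (fun i : Fin m => (i : ℕ) ∈ R),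
        ∑ l, ((C * Cp * U) l i) ^ 2
      ≥ (∑ i ∈ Finset.univ.filter (fun i : Fin n => (i : ℕ) ∈ R),
            ∑ j, ((Vᵀ * S) i j) ^ 2) - ε := by
  rcases R.eq_empty_or_nonempty with rfl | hne
  · simpa using hε
  have hm : ∀ i ∈ R, i < m := fun i hi => (lt_min_iff.mp (hR i hi)).1
  have hn : ∀ i ∈ R, i < n := fun i hi => (lt_min_iff.mp (hR i hi)).2
  have hfin : (σ '' {i : ℕ | i ∈ R}).Finite := R.finite_toSet.image σ
  have hσμ_pos : 0 < σμ := by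
    obtain ⟨i, hi, h⟩ := Set.Nonempty.csInf_mem (hne.to_set.image σ) hfin
    rw [hσμ]
    exact (hRpos i hi).trans_eq h
  have hσμ_le : ∀ i : R, σμ ≤ σ i := fun i =>
    hσμ ▸ csInf_le hfin.bddBelow ⟨i, i.2, rfl⟩
  have hσω_ge : ∀ i, i < m → i < n → i ∉ R → σ i ≤ σω := fun i him hin hi =>
    hσω ▸ le_csSup ⟨σ 0, by rintro _ ⟨j, _, rfl⟩; exact hσ_mono 0 j j.zero_le⟩
      ⟨i, ⟨lt_min him hin, hi⟩, rfl⟩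
  have hVt : (Vᵀ)ᵀ * Vᵀ = 1 := by
    rw [Matrix.transpose_transpose]
    exact mul_eq_one_comm.mp hV
  have hSS : Sᵀ * S = 1 := by
    ext i j
    simp [hS, Matrix.mul_apply, Matrix.one_apply, hf.eq_iff, eq_comm]
  have hCeq := rectDiag_eq σ R hm hn U (Vᵀ * S)
  rw [← Matrix.mul_assoc _ Vᵀ S, ← hA, ← hC] at hCeq
  obtain ⟨hp1, -, hp3, -⟩ := hCp
  have key := sum_sq_proj_ge (U.submatrix id (fun i : R => ⟨i, hm i i.2⟩))
    (by
      ext i j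
      have h := congrFun (congrFun hU ⟨i, hm i i.2⟩) ⟨j, hm j j.2⟩
      simp only [Matrix.one_apply, Fin.mk.injEq, ← Subtype.ext_iff] at h ⊢
      exact h)
    (fun i : R => σ i) ((Vᵀ * S).submatrix (fun i : R => ⟨i, hn i i.2⟩) id)
    (U * rectDiagOutside m n σ R * (Vᵀ * S)) (C * Cp) hp3
    (by rw [← Matrix.mul_assoc, hp1]) (by rw [← hCeq, hp1]) hσμ_pos hσμ_le hσω_pos
    (fun y => by
      have h := rectDiagOutside_mulVec_le σ hσ_nonneg R hn hσω_ge (Vᵀ *ᵥ (S *ᵥ y))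
      rw [dotProduct_orthogonal_mulVec hVt, dotProduct_orthogonal_mulVec hSS] at h
      rw [← Matrix.mulVec_mulVec, ← Matrix.mulVec_mulVec, dotProduct_orthogonal_mulVec hU,
        ← Matrix.mulVec_mulVec]
      convert h using 3
      rw [Matrix.mulVec_mulVec]
      simp [dotProduct, Matrix.mulVec, sq])
  rw [sum_filter_mem_eq R hn] at hVS
  rw [sum_filter_mem_eq R hm, sum_filter_mem_eq R hn, Finset.sum_comm]
  rw [Fintype.card_coe] at key
  have hmul : σω ^ 2 / σμ ^ 2 * (R.card - ∑ i : R, ∑ j, (Vᵀ * S) ⟨i, hn i i.2⟩ j ^ 2) ≤ ε / 2 :=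
    calc _ ≤ σω ^ 2 / σμ ^ 2 * (ε * σμ ^ 2 / (2 * σω ^ 2)) :=
          mul_le_mul_of_nonneg_left (by linarith) (by positivity)
      _ = ε / 2 := by field_simp
  have hbound : _ ≤ ∑ l, ∑ i : R, (C * Cp * U) l ⟨i, hm i i.2⟩ ^ 2 := key
  simp only [Matrix.submatrix_apply, id] at hbound
  linarith
end

section
/- Let A ∈ ℝ^{m×n} have rank ρ and singular value decomposition A = UΣVᵀ, and let κ = σ_1(A)/σ_ρ(A) be its condition number. Let R ⊆ {1,…,ρ} be an index set and ε ≥ 0. If S ∈ ℝ^{n×r} is a column sampling matrix satisfying ‖V_RᵀS‖_F² ≥ |R| − ε/(2κ²), and C = AS, then ‖CC⁺U_R‖_F² ≥ ‖V_RᵀS‖_F² − ε. -/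
open Matrix BigOperators Finset

theorem mulVec_dotProduct_mulVec_self {a b : Type*} [Fintype a] [Fintype b]
    (M : Matrix a b ℝ) (x : b → ℝ) :
    (M *ᵥ x) ⬝ᵥ (M *ᵥ x) = x ⬝ᵥ ((Mᵀ * M) *ᵥ x) := by
  rw [← mulVec_mulVec, dotProduct_mulVec x, vecMul_transpose]

theorem mulVec_dotProduct_mulVec_self_of_transpose_mul_self_eq_one {a b : Type*}
    [Fintype a] [Fintype b] [DecidableEq b] {M : Matrix a b ℝ} (hM : Mᵀ * M = 1) (x : b → ℝ) :
    (M *ᵥ x) ⬝ᵥ (M *ᵥ x) = x ⬝ᵥ x := by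
  rw [mulVec_dotProduct_mulVec_self, hM, one_mulVec]

/-- Pythagoras for the orthogonal projection `M * Mᵀ` onto the range of an isometry `M`. -/
theorem sub_mulVec_dotProduct_self_of_isometry {a b : Type*}
    [Fintype a] [Fintype b] [DecidableEq b] {M : Matrix a b ℝ} (hM : Mᵀ * M = 1) (x : a → ℝ) :
    (x - M *ᵥ (Mᵀ *ᵥ x)) ⬝ᵥ (x - M *ᵥ (Mᵀ *ᵥ x)) = x ⬝ᵥ x - (Mᵀ *ᵥ x) ⬝ᵥ (Mᵀ *ᵥ x) := by
  have h : x ⬝ᵥ (M *ᵥ (Mᵀ *ᵥ x)) = (Mᵀ *ᵥ x) ⬝ᵥ (Mᵀ *ᵥ x) := by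
    rw [dotProduct_mulVec, ← mulVec_transpose]
  rw [sub_dotProduct, dotProduct_sub, dotProduct_sub,
    mulVec_dotProduct_mulVec_self_of_transpose_mul_self_eq_one hM,
    dotProduct_comm (_ *ᵥ _) x, h]
  ring

/-- Pythagoras for a symmetric idempotent matrix. -/
theorem sub_mulVec_dotProduct_self_of_projection {a : Type*} [Fintype a]
    {P : Matrix a a ℝ} (hsymm : Pᵀ = P) (hidem : P * P = P) (x : a → ℝ) :
    (x - P *ᵥ x) ⬝ᵥ (x - P *ᵥ x) = x ⬝ᵥ x - (P *ᵥ x) ⬝ᵥ (P *ᵥ x) := by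
  have h : (P *ᵥ x) ⬝ᵥ (P *ᵥ x) = x ⬝ᵥ (P *ᵥ x) := by
    rw [mulVec_dotProduct_mulVec_self, hsymm, hidem]
  rw [sub_dotProduct, dotProduct_sub, dotProduct_sub, dotProduct_comm (_ *ᵥ _) x, h]
  ring

theorem diagonal_mulVec_dotProduct_self_le {m n : ℕ} {σ : ℕ → ℝ} {c : ℝ}
    (hσ : ∀ i, σ i ^ 2 ≤ c ^ 2) (y : Fin n → ℝ) :
    ((Matrix.of fun (i : Fin m) (j : Fin n) => if (i : ℕ) = (j : ℕ) then σ i else 0) *ᵥ y) ⬝ᵥ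
      ((Matrix.of fun (i : Fin m) (j : Fin n) => if (i : ℕ) = (j : ℕ) then σ i else 0) *ᵥ y)
      ≤ c ^ 2 * (y ⬝ᵥ y) := by
  have hrow : ∀ i : Fin m,
      (∑ j : Fin n, (if (i : ℕ) = (j : ℕ) then σ i else 0) * y j) *
        (∑ j : Fin n, (if (i : ℕ) = (j : ℕ) then σ i else 0) * y j)
      ≤ ∑ j : Fin n, if (i : ℕ) = (j : ℕ) then c ^ 2 * (y j * y j) else 0 := by
    intro i
    by_cases hi : (i : ℕ) < n
    · have hj : ∀ j : Fin n, ((i : ℕ) = (j : ℕ)) ↔ (⟨i, hi⟩ : Fin n) = j := fun j => by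
        simp [Fin.ext_iff]
      simp only [hj, ite_mul, zero_mul, Finset.sum_ite_eq, Finset.mem_univ, if_true]
      nlinarith [mul_le_mul_of_nonneg_right (hσ i) (mul_self_nonneg (y ⟨i, hi⟩))]
    · have hj : ∀ j : Fin n, ¬ (i : ℕ) = (j : ℕ) := fun j h => hi (h ▸ j.isLt)
      simp [hj]
  simp only [dotProduct, mulVec, of_apply]
  refine (Finset.sum_le_sum fun i _ => hrow i).trans ?_
  rw [Finset.sum_comm, Finset.mul_sum]
  refine Finset.sum_le_sum fun j _ => ?_
  have hy : 0 ≤ c ^ 2 * (y j * y j) := mul_nonneg (sq_nonneg c) (mul_self_nonneg _)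
  by_cases hj : (j : ℕ) < m
  · have hi : ∀ i : Fin m, ((i : ℕ) = (j : ℕ)) ↔ i = (⟨j, hj⟩ : Fin m) := fun i => by
      simp [Fin.ext_iff]
    simp [hi]
  · have hi : ∀ i : Fin m, ¬ (i : ℕ) = (j : ℕ) := fun i h => hj (h ▸ i.isLt)
    simpa [hi] using hy

theorem sum_filter_val_mem_eq_sum_attach {k : ℕ} (R : Finset ℕ) (hR : ∀ i ∈ R, i < k)
    (F : Fin k → ℝ) :
    ∑ i ∈ Finset.univ.filter (fun i : Fin k => (i : ℕ) ∈ R), F i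
      = ∑ i ∈ R.attach, F ⟨i, hR i i.2⟩ := by
  symm
  refine Finset.sum_bij (fun i _ => ⟨i, hR i i.2⟩) ?_ ?_ ?_ ?_
  · intro i _
    simp
  · intro i _ j _ h
    exact Subtype.ext (Fin.mk.inj_iff.mp h)
  · intro i hi
    exact ⟨⟨i, (Finset.mem_filter.mp hi).2⟩, Finset.mem_attach _ _, rfl⟩
  · intro i _
    rfl

/-- condition-number corollary: let `A` have rank `ρ` and SVD `A = U Σ Vᵀ`
with singular values `σ_1 ≥ … ≥ σ_ρ > 0` (indexed from `0` here, so `σ_1 = σ 0` and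
`σ_ρ = σ (ρ−1)`), and let `κ = σ_1(A)/σ_ρ(A)` be its condition number.  If
`R ⊆ {1,…,ρ}`, `ε ≥ 0`, `S` is a column sampling matrix with
`‖V_Rᵀ S‖_F² ≥ |R| − ε/(2κ²)`, and `C = A S`, then `‖C C⁺ U_R‖_F² ≥ ‖V_Rᵀ S‖_F² − ε`. -/
theorem stmt14 {m n r : ℕ} (ρ : ℕ)
    (A : Matrix (Fin m) (Fin n) ℝ)
    (U : Matrix (Fin m) (Fin m) ℝ) (V : Matrix (Fin n) (Fin n) ℝ)
    (σ : ℕ → ℝ)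
    (hU : Uᵀ * U = 1) (hV : Vᵀ * V = 1)
    (hσ_nonneg : ∀ i, 0 ≤ σ i)
    (hσ_mono : ∀ i j : ℕ, i ≤ j → σ j ≤ σ i)
    (hA : A = U * (Matrix.of fun (i : Fin m) (j : Fin n) =>
        if (i : ℕ) = (j : ℕ) then σ i else 0) * Vᵀ)
    (hρ_pos : 0 < ρ) (hρ_rank : A.rank = ρ)
    (hσ_pos : ∀ i < ρ, 0 < σ i) (hσ_zero : ∀ i, ρ ≤ i → σ i = 0)
    (κ : ℝ) (hκ : κ = σ 0 / σ (ρ - 1))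
    (R : Finset ℕ) (hR : ∀ i ∈ R, i < ρ)
    (ε : ℝ) (hε : 0 ≤ ε)
    (f : Fin r → Fin n) (hf : Function.Injective f)
    (S : Matrix (Fin n) (Fin r) ℝ)
    (hS : S = Matrix.of fun i j => if i = f j then (1 : ℝ) else 0)
    (hVS : ∑ i ∈ Finset.univ.filter (fun i : Fin n => (i : ℕ) ∈ R),
        ∑ j, ((Vᵀ * S) i j) ^ 2 ≥ (R.card : ℝ) - ε / (2 * κ ^ 2))
    (C : Matrix (Fin m) (Fin r) ℝ) (hC : C = A * S)
    (Cp : Matrix (Fin r) (Fin m) ℝ) (hCp : IsMoorePenrose C Cp) :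
    ∑ i ∈ Finset.univ.filter (fun i : Fin m => (i : ℕ) ∈ R),
        ∑ l, ((C * Cp * U) l i) ^ 2
      ≥ (∑ i ∈ Finset.univ.filter (fun i : Fin n => (i : ℕ) ∈ R),
            ∑ j, ((Vᵀ * S) i j) ^ 2) - ε := by
  obtain ⟨hCPC, -, hsymm, -⟩ := hCp
  set D : Matrix (Fin m) (Fin n) ℝ := Matrix.of fun (i : Fin m) (j : Fin n) =>
    if (i : ℕ) = (j : ℕ) then σ i else 0 with hD
  have hρm : ρ ≤ m := by simpa [hρ_rank] using A.rank_le_height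
  have hρn : ρ ≤ n := by simpa [hρ_rank] using A.rank_le_width
  have hidem : (C * Cp) * (C * Cp) = C * Cp := by rw [← Matrix.mul_assoc, hCPC]
  have hSS : Sᵀ * S = 1 := by
    ext i j
    simp [hS, Matrix.mul_apply, Matrix.one_apply, hf.eq_iff, eq_comm]
  have hAV : A * V = U * D := by rw [hA, Matrix.mul_assoc, hV, Matrix.mul_one]
  have hσ_sq : ∀ i, σ i ^ 2 ≤ σ 0 ^ 2 := fun i =>
    pow_le_pow_left₀ (hσ_nonneg i) (hσ_mono 0 i i.zero_le) 2
  have hA_norm : ∀ x, (A *ᵥ x) ⬝ᵥ (A *ᵥ x) ≤ σ 0 ^ 2 * (x ⬝ᵥ x) := by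
    intro x
    rw [hA, ← mulVec_mulVec, ← mulVec_mulVec,
      mulVec_dotProduct_mulVec_self_of_transpose_mul_self_eq_one hU]
    refine (diagonal_mulVec_dotProduct_self_le hσ_sq _).trans_eq ?_
    rw [mulVec_dotProduct_mulVec_self_of_transpose_mul_self_eq_one
      (by rw [transpose_transpose]; exact mul_eq_one_comm.mp hV)]
  have hσ_last : 0 < σ (ρ - 1) := hσ_pos _ (by omega)
  have hκ_pos : 0 < κ := hκ ▸ div_pos (hσ_pos 0 hρ_pos) hσ_last
  have hκ_mul : κ * σ (ρ - 1) = σ 0 := by rw [hκ]; field_simp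
  have hV_row : ∀ b, ∑ j, ((Vᵀ * S) b j) ^ 2 ≤ 1 := by
    intro b
    have hvv : V.col b ⬝ᵥ V.col b = 1 := by
      simpa [Matrix.mul_apply, dotProduct] using congrFun (congrFun hV b) b
    have hSv : ∑ j, ((Vᵀ * S) b j) ^ 2 = (Sᵀ *ᵥ V.col b) ⬝ᵥ (Sᵀ *ᵥ V.col b) := by
      simp [sq, Matrix.mul_apply, mulVec, dotProduct, mul_comm]
    have h := sub_mulVec_dotProduct_self_of_isometry hSS (V.col b)
    rw [hvv, ← hSv] at h
    exact sub_nonneg.mp (h ▸ Finset.sum_nonneg fun _ _ => mul_self_nonneg _)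
  have key : ∀ i (hi : i < ρ),
      1 - ∑ l, ((C * Cp * U) l ⟨i, hi.trans_le hρm⟩) ^ 2
        ≤ κ ^ 2 * (1 - ∑ j, ((Vᵀ * S) ⟨i, hi.trans_le hρn⟩ j) ^ 2) := by
    intro i hi
    set a : Fin m := ⟨i, hi.trans_le hρm⟩ with ha
    set b : Fin n := ⟨i, hi.trans_le hρn⟩ with hb
    set u : Fin m → ℝ := U.col a with hu
    set v : Fin n → ℝ := V.col b with hv
    have huu : u ⬝ᵥ u = 1 := by
      simpa [Matrix.mul_apply, dotProduct, hu] using congrFun (congrFun hU a) a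
    have hvv : v ⬝ᵥ v = 1 := by
      simpa [Matrix.mul_apply, dotProduct, hv] using congrFun (congrFun hV b) b
    have hAv : A *ᵥ v = σ i • u := by
      ext l
      have h := congrFun (congrFun hAV l) b
      have hk : ∀ k : Fin m, ((k : ℕ) = (b : ℕ)) ↔ k = a := fun k => by
        simp [Fin.ext_iff, ha, hb]
      simp only [Matrix.mul_apply, hD, of_apply, hk, mul_ite, mul_zero, Finset.sum_ite_eq',
        Finset.mem_univ, if_true] at h
      simpa [mulVec, dotProduct, hv, hu, ha, mul_comm] using h
    have hPu : ∑ l, ((C * Cp * U) l a) ^ 2 = ((C * Cp) *ᵥ u) ⬝ᵥ ((C * Cp) *ᵥ u) := by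
      simp only [sq]; rfl
    have hSv : ∑ j, ((Vᵀ * S) b j) ^ 2 = (Sᵀ *ᵥ v) ⬝ᵥ (Sᵀ *ᵥ v) := by
      simp [sq, Matrix.mul_apply, mulVec, dotProduct, hv, mul_comm]
    set x : Fin n → ℝ := v - S *ᵥ (Sᵀ *ᵥ v) with hx
    have hxx := sub_mulVec_dotProduct_self_of_isometry hSS v
    rw [← hx, hvv, ← hSv] at hxx
    have hQu := sub_mulVec_dotProduct_self_of_projection hsymm hidem u
    rw [huu, ← hPu] at hQu
    have hresid : A *ᵥ x - (C * Cp) *ᵥ (A *ᵥ x) = σ i • (u - (C * Cp) *ᵥ u) := by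
      have hAS : A *ᵥ x = σ i • u - C *ᵥ (Sᵀ *ᵥ v) := by
        rw [hx, mulVec_sub, hAv, mulVec_mulVec, ← hC]
      rw [hAS, mulVec_sub, mulVec_mulVec _ (C * Cp) C, hCPC, mulVec_smul, smul_sub]
      abel
    have hle := sub_mulVec_dotProduct_self_of_projection hsymm hidem (A *ᵥ x)
    rw [hresid, smul_dotProduct, dotProduct_smul, hQu] at hle
    simp only [smul_eq_mul] at hle
    have hP_nonneg : 0 ≤ ((C * Cp) *ᵥ (A *ᵥ x)) ⬝ᵥ ((C * Cp) *ᵥ (A *ᵥ x)) :=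
      Finset.sum_nonneg fun _ _ => mul_self_nonneg _
    have hQ_nonneg : 0 ≤ (u - (C * Cp) *ᵥ u) ⬝ᵥ (u - (C * Cp) *ᵥ u) :=
      Finset.sum_nonneg fun _ _ => mul_self_nonneg _
    rw [hQu] at hQ_nonneg
    have hAx := hA_norm x
    rw [hxx] at hAx
    have hσi : σ (ρ - 1) ^ 2 ≤ σ i ^ 2 :=
      pow_le_pow_left₀ hσ_last.le (hσ_mono i (ρ - 1) (by omega)) 2
    have hmul := mul_le_mul_of_nonneg_right hσi hQ_nonneg
    refine le_of_mul_le_mul_left ?_ (pow_pos hσ_last 2)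
    rw [← mul_assoc, ← mul_pow, mul_comm (σ (ρ - 1)) κ, hκ_mul]
    linarith
  have hsum := Finset.sum_le_sum fun (i : R) (_ : i ∈ R.attach) => key i (hR i i.2)
  have hm := sum_filter_val_mem_eq_sum_attach R (fun i hi => (hR i hi).trans_le hρm)
    (fun i => ∑ l, ((C * Cp * U) l i) ^ 2)
  have hn := sum_filter_val_mem_eq_sum_attach R (fun i hi => (hR i hi).trans_le hρn)
    (fun i => ∑ j, ((Vᵀ * S) i j) ^ 2)
  have hV_le : ∑ i ∈ Finset.univ.filter (fun i : Fin n => (i : ℕ) ∈ R),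
      ∑ j, ((Vᵀ * S) i j) ^ 2 ≤ R.card := by
    rw [hn]
    exact (Finset.sum_le_card_nsmul _ _ 1 fun i _ => hV_row _).trans_eq (by simp)
  rw [← Finset.mul_sum, Finset.sum_sub_distrib, Finset.sum_sub_distrib, ← hm, ← hn] at hsum
  simp only [Finset.sum_const, Finset.card_attach, nsmul_eq_mul, mul_one] at hsum
  have hbound : κ ^ 2 * ((R.card : ℝ) - ∑ i ∈ Finset.univ.filter (fun i : Fin n => (i : ℕ) ∈ R),
      ∑ j, ((Vᵀ * S) i j) ^ 2) ≤ κ ^ 2 * (ε / (2 * κ ^ 2)) :=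
    mul_le_mul_of_nonneg_left (by linarith) (sq_nonneg κ)
  have hε_half : κ ^ 2 * (ε / (2 * κ ^ 2)) = ε / 2 := by field_simp
  linarith
end

section
/- Let u, w ∈ ℝ^m be unit vectors, let b ∈ ℝ^m, let 0 ≤ ε ≤ 2 and 0 ≤ δ ≤ 1, and assume uᵀw ≥ √(1 − ε²/4) and uᵀb ≥ √(1 − δ)·‖b‖. Then (wᵀb)² ≥ (1 − ε²/4)(1 − δ)‖b‖² − (ε/2)‖b‖². -/
open RealInnerProductSpace

/-- The Gram determinant inequality for a unit vector `u`, as a Cauchy–Schwarz inequality for the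
components of `w` and `b` orthogonal to `u`. -/
theorem sq_inner_sub_inner_mul_inner_le {E : Type*} [NormedAddCommGroup E] [InnerProductSpace ℝ E]
    (u w b : E) (hu : ‖u‖ = 1) :
    (⟪w, b⟫ - ⟪u, w⟫ * ⟪u, b⟫) ^ 2 ≤
      (‖w‖ ^ 2 - ⟪u, w⟫ ^ 2) * (‖b‖ ^ 2 - ⟪u, b⟫ ^ 2) := by
  have h := real_inner_mul_inner_self_le (w - ⟪u, w⟫ • u) (b - ⟪u, b⟫ • u)
  simp only [inner_sub_left, inner_sub_right, real_inner_smul_left, real_inner_smul_right,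
    real_inner_self_eq_norm_sq, hu, real_inner_comm u w, real_inner_comm u b,
    norm_smul, Real.norm_eq_abs, mul_pow, sq_abs] at h
  linarith

/-- for unit vectors `u, w ∈ ℝ^m`, any `b ∈ ℝ^m`, `0 ≤ ε ≤ 2`, `0 ≤ δ ≤ 1`,
if `uᵀw ≥ √(1 − ε²/4)` and `uᵀb ≥ √(1 − δ)·‖b‖`, then
`(wᵀb)² ≥ (1 − ε²/4)(1 − δ)‖b‖² − (ε/2)‖b‖²`. -/
theorem stmt18 {m : ℕ} (u w b : EuclideanSpace ℝ (Fin m))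
    (hu : ‖u‖ = 1) (hw : ‖w‖ = 1)
    (ε δ : ℝ) (hε0 : 0 ≤ ε) (hε2 : ε ≤ 2) (hδ0 : 0 ≤ δ) (hδ1 : δ ≤ 1)
    (huw : ⟪u, w⟫ ≥ Real.sqrt (1 - ε ^ 2 / 4))
    (hub : ⟪u, b⟫ ≥ Real.sqrt (1 - δ) * ‖b‖) :
    ⟪w, b⟫ ^ 2 ≥ (1 - ε ^ 2 / 4) * (1 - δ) * ‖b‖ ^ 2 - (ε / 2) * ‖b‖ ^ 2 := by
  set p := ⟪u, w⟫
  set q := ⟪u, b⟫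
  set r := ⟪w, b⟫
  have hgram : (r - p * q) ^ 2 ≤ (1 - p ^ 2) * (‖b‖ ^ 2 - q ^ 2) := by
    simpa [hw] using sq_inner_sub_inner_mul_inner_le u w b hu
  have hp0 : 0 ≤ p := (Real.sqrt_nonneg _).trans huw
  have hq0 : 0 ≤ q := (by positivity : 0 ≤ √(1 - δ) * ‖b‖).trans hub
  have hp1 : p ≤ 1 := by simpa [hu, hw] using real_inner_le_norm u w
  have hqb : q ≤ ‖b‖ := by simpa [hu] using real_inner_le_norm u b
  have hp : 1 - ε ^ 2 / 4 ≤ p ^ 2 := (Real.sqrt_le_left hp0).mp huw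
  have hq : (1 - δ) * ‖b‖ ^ 2 ≤ q ^ 2 := by
    have h := pow_le_pow_left₀ (by positivity) hub 2
    rwa [mul_pow, Real.sq_sqrt (by linarith)] at h
  have hpq : (1 - ε ^ 2 / 4) * (1 - δ) * ‖b‖ ^ 2 ≤ p ^ 2 * q ^ 2 := by
    rw [mul_assoc]
    exact mul_le_mul hp hq (mul_nonneg (by linarith) (sq_nonneg _)) (sq_nonneg _)
  have hd : |r - p * q| ≤ ε / 2 * √(‖b‖ ^ 2 - q ^ 2) := by
    have hQ : 0 ≤ ‖b‖ ^ 2 - q ^ 2 := sub_nonneg.mpr (pow_le_pow_left₀ hq0 hqb 2)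
    refine abs_le_of_sq_le_sq (hgram.trans ?_) (by positivity)
    rw [mul_pow, Real.sq_sqrt hQ]
    exact mul_le_mul_of_nonneg_right (by linarith) hQ
  have hQ2 : 2 * q * √(‖b‖ ^ 2 - q ^ 2) ≤ ‖b‖ ^ 2 := by
    have h := two_mul_le_add_sq q √(‖b‖ ^ 2 - q ^ 2)
    rwa [Real.sq_sqrt (sub_nonneg.mpr (pow_le_pow_left₀ hq0 hqb 2)), add_sub_cancel] at h
  have hcross : 2 * (p * q) * |r - p * q| ≤ ε / 2 * ‖b‖ ^ 2 :=
    calc 2 * (p * q) * |r - p * q|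
        ≤ 2 * (1 * q) * (ε / 2 * √(‖b‖ ^ 2 - q ^ 2)) := by gcongr
      _ = ε / 2 * (2 * q * √(‖b‖ ^ 2 - q ^ 2)) := by ring
      _ ≤ ε / 2 * ‖b‖ ^ 2 := by gcongr
  have hneg := mul_le_mul_of_nonneg_left (neg_abs_le (r - p * q))
    (by positivity : 0 ≤ 2 * (p * q))
  nlinarith [sq_nonneg (r - p * q)]
end
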